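/- arXiv:2305.08004 — 8 statements merged into one kernel-verified Lean document; each statement's English description precedes it below -/
import Mathlib

section
/- Let H₁, H₂, ρ₁, ρ₂ ∈ M_d(ℂ) be Hermitian matrices satisfying ρ₁ρ₂ = ρ₂ρ₁ = 0, H₁ρ₂ = ρ₂H₁ = 0 and H₂ρ₁ = ρ₁H₂ = 0, and set H := H₁ + H₂. Then for every λ ∈ [0,1]: −Tr([H, λρ₁ + (1−λ)ρ₂]²) = λ²·(−Tr([H,ρ₁]²)) + (1−λ)²·(−Tr([H,ρ₂]²)). -/
open Matrix Complex

/-- Commutators of blocks whose states annihilate each other and the opposite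
Hamiltonian are orthogonal for the trace form. -/
theorem trace_commutator_mul_commutator_eq_zero {n R : Type*} [Fintype n] [CommRing R]
    {H₁ H₂ ρ₁ ρ₂ : Matrix n n R} (h12 : ρ₁ * ρ₂ = 0) (h21 : ρ₂ * ρ₁ = 0)
    (hH₁ρ₂ : H₁ * ρ₂ = 0) (hρ₁H₂ : ρ₁ * H₂ = 0) :
    ((H₁ * ρ₁ - ρ₁ * H₁) * (H₂ * ρ₂ - ρ₂ * H₂)).trace = 0 := by
  have h : (H₁ * ρ₁ - ρ₁ * H₁) * (H₂ * ρ₂ - ρ₂ * H₂) = -(ρ₁ * (H₁ * H₂ * ρ₂)) := by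
    calc
      _ = H₁ * (ρ₁ * H₂) * ρ₂ - H₁ * (ρ₁ * ρ₂) * H₂ - ρ₁ * (H₁ * H₂ * ρ₂)
          + ρ₁ * (H₁ * ρ₂) * H₂ := by noncomm_ring
      _ = _ := by simp [h12, hH₁ρ₂, hρ₁H₂]
  rw [h, trace_neg, trace_mul_comm, Matrix.mul_assoc, h21, Matrix.mul_zero, trace_zero, neg_zero]

/-- If the Hamiltonian `H = H₁ + H₂` is partitioned over two
complementary orthogonal subspaces on which the orthogonal states `ρ₁, ρ₂` act,
then the squared speed of the mixture `λρ₁ + (1−λ)ρ₂` decomposes quadratically. -/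
theorem sqSpeed_directSum {d : ℕ} (H₁ H₂ ρ₁ ρ₂ : Matrix (Fin d) (Fin d) ℂ)
    (hH₁ : H₁.IsHermitian) (hH₂ : H₂.IsHermitian)
    (hρ₁ : ρ₁.IsHermitian) (hρ₂ : ρ₂.IsHermitian)
    (h12 : ρ₁ * ρ₂ = 0) (h21 : ρ₂ * ρ₁ = 0)
    (hH₁ρ₂ : H₁ * ρ₂ = 0) (hρ₂H₁ : ρ₂ * H₁ = 0)
    (hH₂ρ₁ : H₂ * ρ₁ = 0) (hρ₁H₂ : ρ₁ * H₂ = 0)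
    (H ρ : Matrix (Fin d) (Fin d) ℂ) (hH : H = H₁ + H₂)
    (lam : ℝ) (hlam : lam ∈ Set.Icc (0:ℝ) 1)
    (hρ : ρ = (lam : ℂ) • ρ₁ + ((1 - lam : ℝ) : ℂ) • ρ₂) :
    -(((H * ρ - ρ * H) * (H * ρ - ρ * H)).trace)
      = ((lam : ℂ))^2 * (-(((H * ρ₁ - ρ₁ * H) * (H * ρ₁ - ρ₁ * H)).trace))
      + (((1 - lam : ℝ) : ℂ))^2 * (-(((H * ρ₂ - ρ₂ * H) * (H * ρ₂ - ρ₂ * H)).trace)) := by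
  have h₁ : H * ρ₁ - ρ₁ * H = H₁ * ρ₁ - ρ₁ * H₁ := by
    simp [hH, add_mul, mul_add, hH₂ρ₁, hρ₁H₂]
  have h₂ : H * ρ₂ - ρ₂ * H = H₂ * ρ₂ - ρ₂ * H₂ := by
    simp [hH, add_mul, mul_add, hH₁ρ₂, hρ₂H₁]
  have hmix : H * ρ - ρ * H = (lam : ℂ) • (H₁ * ρ₁ - ρ₁ * H₁)
      + ((1 - lam : ℝ) : ℂ) • (H₂ * ρ₂ - ρ₂ * H₂) := by
    rw [← h₁, ← h₂, hρ]
    simp only [mul_add, add_mul, mul_smul_comm, smul_mul_assoc, smul_sub]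
    abel
  have hcross := trace_commutator_mul_commutator_eq_zero h12 h21 hH₁ρ₂ hρ₁H₂
  rw [hmix, h₁, h₂]
  generalize H₁ * ρ₁ - ρ₁ * H₁ = A at *
  generalize H₂ * ρ₂ - ρ₂ * H₂ = B at *
  have hcross' : (B * A).trace = 0 := by rw [trace_mul_comm, hcross]
  simp only [mul_add, add_mul, mul_smul_comm, smul_mul_assoc, trace_add, trace_smul,
    smul_eq_mul, hcross, hcross']
  ring
end

section
/- Let ρ ∈ M_d(ℂ) be a density matrix (positive semidefinite with Tr(ρ) = 1) and let H ∈ M_d(ℂ) be Hermitian. Then −Tr([H,ρ]²) ≤ 2(Tr(H²ρ) − (Tr(Hρ))²), i.e., the squared speed of evolution is bounded above by twice the energy variance. -/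
open Matrix Complex
open scoped ComplexOrder

/-- The eigenvalues of a density matrix lie in `[0, 1]`, so `ρ - ρ²` is positive semidefinite. -/
theorem posSemidef_sub_mul_self_of_trace_eq_one {n : Type*} [Fintype n] [DecidableEq n]
    {ρ : Matrix n n ℂ} (hρ : ρ.PosSemidef) (hTr : ρ.trace = 1) :
    (ρ - ρ * ρ).PosSemidef := by
  have hsum : ∑ i, hρ.1.eigenvalues i = 1 := by
    have h := hρ.1.trace_eq_sum_eigenvalues
    rw [hTr] at h
    refine Complex.ofReal_injective ?_
    rw [Complex.ofReal_sum, Complex.ofReal_one]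
    exact h.symm
  have hle (i : n) : hρ.1.eigenvalues i ≤ 1 :=
    hsum ▸ Finset.single_le_sum (fun j _ => hρ.eigenvalues_nonneg j) (Finset.mem_univ i)
  set U : Matrix n n ℂ := (hρ.1.eigenvectorUnitary : Matrix n n ℂ)
  set D : Matrix n n ℂ := diagonal (fun i => (hρ.1.eigenvalues i : ℂ)) with hD
  have hspec : ρ = U * D * Uᴴ := by
    have h := hρ.1.spectral_theorem
    rw [Unitary.conjStarAlgAut_apply] at h
    exact h
  have hUU : Uᴴ * U = 1 := Unitary.coe_star_mul_self hρ.1.eigenvectorUnitary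
  have hsq : ρ * ρ = U * (D * D) * Uᴴ := by
    calc ρ * ρ = U * D * (Uᴴ * U) * D * Uᴴ := by
          nth_rw 1 2 [hspec]
          simp only [Matrix.mul_assoc]
      _ = U * (D * D) * Uᴴ := by rw [hUU]; simp only [Matrix.mul_one, Matrix.mul_assoc]
  have hdiff : ρ - ρ * ρ = U * (D - D * D) * Uᴴ := by
    rw [hsq, Matrix.mul_sub, Matrix.sub_mul, ← hspec]
  rw [hdiff]
  refine PosSemidef.mul_mul_conjTranspose_same ?_ U
  rw [hD, diagonal_mul_diagonal, diagonal_sub]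
  refine PosSemidef.diagonal fun i => ?_
  have h : 0 ≤ hρ.1.eigenvalues i - hρ.1.eigenvalues i * hρ.1.eigenvalues i := by
    nlinarith [hle i, hρ.eigenvalues_nonneg i]
  change (0 : ℂ) ≤ (hρ.1.eigenvalues i : ℂ) - hρ.1.eigenvalues i * hρ.1.eigenvalues i
  exact_mod_cast h

/-- `Tr(KρKρ) ≥ 0` for Hermitian `K` and positive semidefinite `ρ`. -/
theorem trace_mul_mul_mul_self_nonneg {n : Type*} [Fintype n] [DecidableEq n]
    {K ρ : Matrix n n ℂ} (hK : K.IsHermitian) (hρ : ρ.PosSemidef) :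
    0 ≤ (K * ρ * K * ρ).trace := by
  obtain ⟨B, rfl⟩ : ∃ B : Matrix n n ℂ, ρ = Bᴴ * B := by
    open scoped MatrixOrder in
    exact CStarAlgebra.nonneg_iff_eq_star_mul_self.mp hρ.nonneg
  have h : (K * (Bᴴ * B) * K * (Bᴴ * B)).trace = ((B * K * Bᴴ) * (B * K * Bᴴ)ᴴ).trace := by
    rw [← Matrix.mul_assoc _ Bᴴ B, trace_mul_comm]
    simp only [conjTranspose_mul, conjTranspose_conjTranspose, hK.eq, Matrix.mul_assoc]
  rw [h]
  exact (posSemidef_self_mul_conjTranspose _).trace_nonneg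

/-- For a density matrix `ρ` and Hermitian `H`, the squared speed
is bounded above by twice the energy variance: `−Tr([H,ρ]²) ≤ 2(Tr(H²ρ) − Tr(Hρ)²)`. -/
theorem sqSpeed_le_two_variance {d : ℕ} (H ρ : Matrix (Fin d) (Fin d) ℂ)
    (hH : H.IsHermitian) (hρ : ρ.PosSemidef) (hTr : ρ.trace = 1) :
    (-(((H * ρ - ρ * H) * (H * ρ - ρ * H)).trace)).re
      ≤ 2 * (((H * H * ρ).trace).re - (((H * ρ).trace).re)^2) := by
  set c : ℝ := ((H * ρ).trace).re
  set K : Matrix (Fin d) (Fin d) ℂ := H - (c : ℂ) • 1 with hKdef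
  have hK : K.IsHermitian := by
    simp [hKdef, Matrix.IsHermitian, hH.eq]
  have hcomm : H * ρ - ρ * H = K * ρ - ρ * K := by
    simp [hKdef, Matrix.sub_mul, Matrix.mul_sub]
  have hvar : ((K * K * ρ).trace).re = ((H * H * ρ).trace).re - c ^ 2 := by
    have h : K * K * ρ = H * H * ρ - (2 * c : ℂ) • (H * ρ) + (c ^ 2 : ℂ) • ρ := by
      simp only [hKdef, Matrix.sub_mul, Matrix.mul_sub, Matrix.smul_mul, Matrix.mul_smul,
        Matrix.one_mul, Matrix.mul_one]
      module
    rw [h, trace_add, trace_sub, trace_smul, trace_smul, hTr]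
    have h2 : ((2 * c : ℂ) • (H * ρ).trace).re = 2 * c * c := by
      rw [smul_eq_mul, show (2 * c : ℂ) = ((2 * c : ℝ) : ℂ) by push_cast; rfl,
        Complex.re_ofReal_mul]
    have h3 : ((c ^ 2 : ℂ) • (1 : ℂ)).re = c ^ 2 := by
      rw [smul_eq_mul, mul_one, ← Complex.ofReal_pow, Complex.ofReal_re]
    rw [Complex.add_re, Complex.sub_re, h2, h3]
    ring
  clear_value K
  have hspeed : -((K * ρ - ρ * K) * (K * ρ - ρ * K)).trace
      = 2 * ((K * K * (ρ * ρ)).trace - (K * ρ * K * ρ).trace) := by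
    have h1 : (K * ρ * (ρ * K)).trace = (K * K * (ρ * ρ)).trace := by
      rw [← Matrix.mul_assoc, trace_mul_comm]
      simp only [Matrix.mul_assoc]
    have h2 : (ρ * K * (K * ρ)).trace = (K * K * (ρ * ρ)).trace := by
      rw [Matrix.mul_assoc, trace_mul_comm]
      simp only [Matrix.mul_assoc]
    have h3 : (K * ρ * (K * ρ)).trace = (K * ρ * K * ρ).trace := by
      simp only [Matrix.mul_assoc]
    have h4 : (ρ * K * (ρ * K)).trace = (K * ρ * K * ρ).trace := by
      rw [Matrix.mul_assoc, trace_mul_comm]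
      simp only [Matrix.mul_assoc]
    rw [Matrix.sub_mul, Matrix.mul_sub, Matrix.mul_sub, trace_sub, trace_sub, trace_sub,
      h1, h2, h3, h4]
    ring
  have hpos : 0 ≤ (K * K * ρ).trace - (K * K * (ρ * ρ)).trace := by
    have h := ((posSemidef_sub_mul_self_of_trace_eq_one hρ hTr).mul_mul_conjTranspose_same
      K).trace_nonneg
    rwa [hK.eq, trace_mul_comm, ← Matrix.mul_assoc, Matrix.mul_sub, trace_sub] at h
  have hre := (Complex.le_def.mp hpos).1
  have hre' := (Complex.le_def.mp (trace_mul_mul_mul_self_nonneg hK hρ)).1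
  rw [Complex.zero_re] at hre hre'
  rw [Complex.sub_re] at hre
  rw [hcomm, hspeed, ← hvar, show (2 : ℂ) = ((2 : ℝ) : ℂ) by norm_num, Complex.re_ofReal_mul,
    Complex.sub_re]
  linarith
end

section
/- Let H = diag(E₁,…,E_d) ∈ M_d(ℂ) be a real diagonal matrix with pairwise distinct diagonal entries E₁ < E₂ < ⋯ < E_d, and let ρ ∈ M_d(ℂ) be a density matrix. Then −Tr([H,ρ]²) = 2(Tr(H²ρ) − (Tr(Hρ))²) holds if and only if ρ is a pure state, i.e., ρ² = ρ (equivalently, ρ is a rank-one projection; equivalently, ρ_{ii}ρ_{jj} = |ρ_{ij}|² for all i < j). -/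
open Matrix Complex
open scoped ComplexOrder

namespace Matrix.PosSemidef

variable {n : Type*} {ρ : Matrix n n ℂ}

theorem minor_nonneg (hρ : ρ.PosSemidef) (i j : n) :
    0 ≤ ρ i i * ρ j j - ρ i j * ρ j i := by
  have h := (hρ.submatrix ![i, j]).det_nonneg
  rwa [det_fin_two] at h

variable [Fintype n]

theorem mul_apply_eq_of_minor_eq_zero [DecidableEq n] (hρ : ρ.PosSemidef) {i j : n}
    (h : ρ i i * ρ j j - ρ i j * ρ j i = 0) (k : n) :
    ρ k i * ρ j j = ρ k j * ρ j i := by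
  have hjj : star (ρ j j) = ρ j j := hρ.isHermitian.apply j j
  have hij : star (ρ j i) = ρ i j := hρ.isHermitian.apply i j
  have hv : ρ *ᵥ (Pi.single i (ρ j j) - Pi.single j (ρ j i)) = 0 := by
    rw [← hρ.dotProduct_mulVec_zero_iff]
    simp only [star_sub, Pi.star_single, hjj, hij, mulVec_sub, sub_dotProduct, single_dotProduct,
      mulVec_single, Pi.sub_apply, Pi.smul_apply, MulOpposite.smul_eq_mul_unop,
      MulOpposite.unop_op, col_apply]
    linear_combination ρ j j * h
  have hk := congrFun hv k
  simpa [mulVec_sub, mulVec_single, sub_eq_zero, mul_comm] using hk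

/-- A density matrix is a projection iff all its principal `2 × 2` minors vanish. -/
theorem mul_self_eq_self_iff_minor_eq_zero (hρ : ρ.PosSemidef) (hTr : ρ.trace = 1) :
    ρ * ρ = ρ ↔ ∀ i j, ρ i i * ρ j j - ρ i j * ρ j i = 0 := by
  classical
  constructor
  · intro h
    have hsum : ∑ i, ∑ j, (ρ i i * ρ j j - ρ i j * ρ j i) = 0 := by
      have h1 : ∑ i, ∑ j, ρ i i * ρ j j = 1 := by
        rw [← Finset.sum_mul_sum]
        change ρ.trace * ρ.trace = 1
        simp [hTr]
      have h2 : ∑ i, ∑ j, ρ i j * ρ j i = 1 := by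
        rw [← hTr, ← congrArg trace h]
        simp [trace, mul_apply]
      simp [Finset.sum_sub_distrib, h1, h2]
    intro i j
    rw [Finset.sum_eq_zero_iff_of_nonneg
      fun i _ => Finset.sum_nonneg fun j _ => hρ.minor_nonneg i j] at hsum
    exact (Finset.sum_eq_zero_iff_of_nonneg fun j _ => hρ.minor_nonneg i j).1
      (hsum i (Finset.mem_univ i)) j (Finset.mem_univ j)
  · intro h
    ext k i
    rw [mul_apply, ← Finset.sum_congr rfl fun j _ => hρ.mul_apply_eq_of_minor_eq_zero (h i j) k,
      ← Finset.mul_sum]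
    change ρ k i * ρ.trace = ρ k i
    rw [hTr, mul_one]

end Matrix.PosSemidef

theorem two_variance_sub_sqSpeed_eq_sum {n : Type*} [Fintype n] [DecidableEq n] (e : n → ℂ)
    {ρ : Matrix n n ℂ} (hTr : ρ.trace = 1) :
    2 * ((diagonal e * diagonal e * ρ).trace - ((diagonal e * ρ).trace) ^ 2)
        - -(((diagonal e * ρ - ρ * diagonal e) * (diagonal e * ρ - ρ * diagonal e)).trace)
      = ∑ i, ∑ j, (e i - e j) ^ 2 * (ρ i i * ρ j j - ρ i j * ρ j i) := by
  have hp : ∑ i, ρ i i = 1 := hTr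
  have hspeed : ((diagonal e * ρ - ρ * diagonal e) * (diagonal e * ρ - ρ * diagonal e)).trace
      = -∑ i, ∑ j, (e i - e j) ^ 2 * (ρ i j * ρ j i) := by
    simp only [trace, diag_apply, mul_apply (M := _ - _), Matrix.sub_apply, diagonal_mul, mul_diagonal,
      ← Finset.sum_neg_distrib]
    exact Finset.sum_congr rfl fun i _ => Finset.sum_congr rfl fun j _ => by ring
  have hvar : ∑ i, ∑ j, (e i - e j) ^ 2 * (ρ i i * ρ j j)
      = 2 * ((∑ i, e i * e i * ρ i i) - (∑ i, e i * ρ i i) ^ 2) := by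
    have hexp : ∀ i j, (e i - e j) ^ 2 * (ρ i i * ρ j j)
        = (e i * e i * ρ i i) * ρ j j + ρ i i * (e j * e j * ρ j j)
          - 2 * ((e i * ρ i i) * (e j * ρ j j)) := fun i j => by ring
    simp only [hexp, Finset.sum_sub_distrib, Finset.sum_add_distrib, ← Finset.mul_sum,
      ← Finset.sum_mul, hp]
    ring
  rw [hspeed]
  simp only [mul_sub (_ ^ 2), Finset.sum_sub_distrib, hvar]
  simp [trace, diagonal_mul, diagonal_mul_diagonal]

/-- For real diagonal `H` with strictly increasing diagonal entries
and a density matrix `ρ`, the squared speed equals twice the energy variance iff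
`ρ` is pure, i.e. `ρ² = ρ`. -/
theorem sqSpeed_eq_two_variance_iff_pure {d : ℕ} (E : Fin d → ℝ)
    (hE : StrictMono E)
    (H ρ : Matrix (Fin d) (Fin d) ℂ)
    (hH : H = Matrix.diagonal fun i => (E i : ℂ))
    (hρ : ρ.PosSemidef) (hTr : ρ.trace = 1) :
    -(((H * ρ - ρ * H) * (H * ρ - ρ * H)).trace)
        = 2 * ((H * H * ρ).trace - ((H * ρ).trace)^2)
      ↔ ρ * ρ = ρ := by
  have hterm : ∀ i j, 0 ≤ ((E i : ℂ) - E j) ^ 2 * (ρ i i * ρ j j - ρ i j * ρ j i) := by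
    intro i j
    refine mul_nonneg ?_ (hρ.minor_nonneg i j)
    exact_mod_cast sq_nonneg (E i - E j)
  rw [hρ.mul_self_eq_self_iff_minor_eq_zero hTr, eq_comm, ← sub_eq_zero, hH,
    two_variance_sub_sqSpeed_eq_sum _ hTr,
    Finset.sum_eq_zero_iff_of_nonneg fun i _ => Finset.sum_nonneg fun j _ => hterm i j]
  simp only [Finset.sum_eq_zero_iff_of_nonneg fun j _ => hterm _ j, Finset.mem_univ,
    forall_true_left]
  refine forall₂_congr fun i j => ?_
  rcases eq_or_ne i j with rfl | hij
  · simp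
  · have : (E i : ℂ) - E j ≠ 0 := sub_ne_zero.2 fun h => hij (hE.injective (by exact_mod_cast h))
    simp [this]
end

section
/- Let H = diag(E₁,…,E_d) ∈ M_d(ℂ) be a real diagonal matrix with E₁ ≤ E₂ ≤ ⋯ ≤ E_d, and let κ ∈ [1/d, 1]. For every density matrix ρ ∈ M_d(ℂ) with Tr(ρ²) = κ there exists a density matrix σ ∈ M_d(ℂ) with Tr(σ²) = κ such that σ is a persymmetric X-state — i.e., σ_{ij} = 0 whenever i ≠ j and i + j ≠ d + 1, and σ_{ij} = σ_{d+1−j, d+1−i} for all i, j — and −Tr([H,σ]²) ≥ −Tr([H,ρ]²). In other words, the maximum of the squared speed over density matrices of purity κ is attained on a persymmetric X-state. -/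
open Matrix Complex
open scoped ComplexOrder

lemma Matrix.IsHermitian.re_trace_mul_self {n : Type*} [Fintype n] {A : Matrix n n ℂ}
    (hA : A.IsHermitian) :
    ((A * A).trace).re = ∑ i, ∑ j, normSq (A i j) := by
  simp only [trace, diag_apply, mul_apply, re_sum]
  refine Finset.sum_congr rfl fun i _ => Finset.sum_congr rfl fun j _ => ?_
  rw [← hA.apply i j, RCLike.star_def, ← normSq_eq_conj_mul_self, ofReal_re, normSq_conj]

section UnitaryConjugation

variable {n : Type*} [Fintype n] [DecidableEq n]

/-- The Hermitian matrix with eigenvalues `x` and eigenvectors the columns of `U`. -/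
def conjDiagonal (U : Matrix n n ℂ) (x : n → ℝ) : Matrix n n ℂ :=
  U * diagonal (fun i => (x i : ℂ)) * Uᴴ

lemma isHermitian_conjDiagonal (U : Matrix n n ℂ) (x : n → ℝ) :
    (conjDiagonal U x).IsHermitian := by
  simp only [conjDiagonal, IsHermitian, conjTranspose_mul, conjTranspose_conjTranspose,
    diagonal_conjTranspose, Matrix.mul_assoc]
  congr 3
  ext i
  simp

lemma mul_conjDiagonal_mul_conjTranspose (V U : Matrix n n ℂ) (x : n → ℝ) :
    V * conjDiagonal U x * Vᴴ = conjDiagonal (V * U) x := by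
  simp only [conjDiagonal, conjTranspose_mul, Matrix.mul_assoc]

lemma conjDiagonal_neg (U : Matrix n n ℂ) (x : n → ℝ) :
    conjDiagonal U (fun i => -x i) = -conjDiagonal U x := by
  have h : diagonal (fun i => ((-x i : ℝ) : ℂ)) = -diagonal (fun i => (x i : ℂ)) := by
    rw [diagonal_neg]
    push_cast
    rfl
  rw [conjDiagonal, h, conjDiagonal, Matrix.mul_neg, Matrix.neg_mul]

lemma conjDiagonal_reindex (U : Matrix n n ℂ) (x : n → ℝ) (e : n ≃ n) :
    conjDiagonal (U.submatrix id e) (x ∘ e) = conjDiagonal U x := by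
  have h : diagonal (fun i => ((x ∘ e) i : ℂ)) =
      (diagonal (fun i => (x i : ℂ))).submatrix e e :=
    (submatrix_diagonal_equiv (fun i => (x i : ℂ)) e).symm
  rw [conjDiagonal, conjDiagonal, h, conjTranspose_submatrix, submatrix_mul_equiv,
    submatrix_mul_equiv, submatrix_id_id]

lemma submatrix_mul_conjTranspose {U : Matrix n n ℂ} (hU : U * Uᴴ = 1) (e : n ≃ n) :
    U.submatrix id e * (U.submatrix id e)ᴴ = 1 := by
  rw [conjTranspose_submatrix, submatrix_mul_equiv, hU, submatrix_id_id]

lemma mul_mul_conjTranspose_self {U V : Matrix n n ℂ} (hU : U * Uᴴ = 1) (hV : V * Vᴴ = 1) :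
    (U * V) * (U * V)ᴴ = 1 := by
  rw [conjTranspose_mul, Matrix.mul_assoc, ← Matrix.mul_assoc V, hV, Matrix.one_mul, hU]

lemma conjTranspose_mul_self_eq_one {U : Matrix n n ℂ} (hU : U * Uᴴ = 1) : Uᴴ * U = 1 :=
  mul_eq_one_comm.mp hU

lemma trace_mul_mul_conjTranspose {U : Matrix n n ℂ} (hU : U * Uᴴ = 1) (A : Matrix n n ℂ) :
    (U * A * Uᴴ).trace = A.trace := by
  rw [trace_mul_cycle, conjTranspose_mul_self_eq_one hU, Matrix.one_mul]

lemma mul_mul_conjTranspose_mul {U : Matrix n n ℂ} (hU : U * Uᴴ = 1) (A B : Matrix n n ℂ) :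
    (U * A * Uᴴ) * (U * B * Uᴴ) = U * (A * B) * Uᴴ := by
  have h := conjTranspose_mul_self_eq_one hU
  calc (U * A * Uᴴ) * (U * B * Uᴴ) = U * A * (Uᴴ * U) * B * Uᴴ := by
        simp only [Matrix.mul_assoc]
    _ = U * (A * B) * Uᴴ := by rw [h, Matrix.mul_one, Matrix.mul_assoc U]

lemma trace_conjDiagonal {U : Matrix n n ℂ} (hU : U * Uᴴ = 1) (x : n → ℝ) :
    (conjDiagonal U x).trace = ∑ i, (x i : ℂ) := by
  rw [conjDiagonal, trace_mul_mul_conjTranspose hU, trace_diagonal]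

lemma trace_conjDiagonal_mul_self {U : Matrix n n ℂ} (hU : U * Uᴴ = 1) (x : n → ℝ) :
    (conjDiagonal U x * conjDiagonal U x).trace = ∑ i, (x i : ℂ) * x i := by
  rw [conjDiagonal, mul_mul_conjTranspose_mul hU, trace_mul_mul_conjTranspose hU,
    diagonal_mul_diagonal, trace_diagonal]

lemma posSemidef_conjDiagonal (U : Matrix n n ℂ) {x : n → ℝ} (hx : ∀ i, 0 ≤ x i) :
    (conjDiagonal U x).PosSemidef :=
  (PosSemidef.diagonal fun i => Complex.zero_le_real.mpr (hx i)).mul_mul_conjTranspose_same U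

/-- The squared speed in an eigenbasis of one of the two matrices. -/
lemma Matrix.IsHermitian.neg_trace_commutator_sq {A : Matrix n n ℂ} (hA : A.IsHermitian)
    (x : n → ℝ) :
    (-(((diagonal (fun i => (x i : ℂ)) * A - A * diagonal (fun i => (x i : ℂ))) *
      (diagonal (fun i => (x i : ℂ)) * A - A * diagonal (fun i => (x i : ℂ)))).trace)).re =
      ∑ i, ∑ j, (x i - x j) ^ 2 * normSq (A i j) := by
  simp only [trace, diag_apply, mul_apply, neg_re, re_sum, ← Finset.sum_neg_distrib]
  refine Finset.sum_congr rfl fun i _ => Finset.sum_congr rfl fun j _ => ?_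
  simp only [sub_apply, diagonal_mul, mul_diagonal]
  rw [← hA.apply j i, RCLike.star_def]
  simp only [normSq_apply, mul_re, sub_re, sub_im, mul_im, ofReal_re, ofReal_im, conj_re, conj_im]
  ring

lemma sum_normSq_row {U : Matrix n n ℂ} (hU : U * Uᴴ = 1) (i : n) :
    ∑ j, normSq (U i j) = 1 := by
  have h := congrFun (congrFun hU i) i
  rw [mul_apply, one_apply_eq] at h
  have h2 := congrArg Complex.re h
  rw [re_sum, one_re] at h2
  rw [← h2]
  refine Finset.sum_congr rfl fun j _ => ?_
  rw [conjTranspose_apply, RCLike.star_def, mul_conj, ofReal_re]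

lemma unistochastic_mem_doublyStochastic {U : Matrix n n ℂ} (hU : U * Uᴴ = 1) :
    (Matrix.of fun i j => normSq (U i j)) ∈ doublyStochastic ℝ n := by
  rw [mem_doublyStochastic_iff_sum]
  refine ⟨fun i j => normSq_nonneg _, sum_normSq_row hU, fun j => ?_⟩
  have h := sum_normSq_row (U := Uᴴ)
    (by rw [conjTranspose_conjTranspose]; exact conjTranspose_mul_self_eq_one hU) j
  simpa [conjTranspose_apply, normSq_conj] using h

/-- A matrix supported on the rows and columns meeting an index set `I` has at most `#I`
positive eigenvalues. -/
lemma card_le_card_of_conjDiagonal_pos {U : Matrix n n ℂ} (hU : U * Uᴴ = 1) (x : n → ℝ)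
    (I K : Finset n) (hI : ∀ i j, i ∉ I → j ∉ I → conjDiagonal U x i j = 0)
    (hK : ∀ k ∈ K, 0 < x k) : K.card ≤ I.card := by
  by_contra! hlt
  let f : ({k // k ∈ K} → ℂ) →ₗ[ℂ] ({i // i ∈ I} → ℂ) :=
    (U.submatrix (Subtype.val : {i // i ∈ I} → n) (Subtype.val : {k // k ∈ K} → n)).mulVecLin
  have hker : LinearMap.ker f ≠ ⊥ := f.ker_ne_bot_of_finrank_lt (by simpa using hlt)
  obtain ⟨c, hc, hc0⟩ := Submodule.exists_mem_ne_zero_of_ne_bot hker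
  let e : n → ℂ := fun k => if h : k ∈ K then c ⟨k, h⟩ else 0
  have hUe : ∀ i ∈ I, (U *ᵥ e) i = 0 := by
    intro i hi
    have h1 := congrFun (LinearMap.mem_ker.mp hc) ⟨i, hi⟩
    simp only [f, mulVecLin_apply, mulVec, dotProduct, submatrix_apply, Pi.zero_apply] at h1
    rw [mulVec, dotProduct, ← h1, ← Finset.sum_subset (Finset.subset_univ K)]
    · rw [← Finset.sum_coe_sort K]
      refine Finset.sum_congr rfl fun k _ => ?_
      simp [e]
    · intro k _ hk
      simp [e, hk]
  have hvanish : ∀ z : n → ℂ, (∀ i ∈ I, z i = 0) → star z ⬝ᵥ (conjDiagonal U x *ᵥ z) = 0 := by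
    intro z hz
    simp only [dotProduct, mulVec, Finset.mul_sum]
    refine Finset.sum_eq_zero fun i _ => Finset.sum_eq_zero fun j _ => ?_
    by_cases hi : i ∈ I
    · simp [hz i hi]
    by_cases hj : j ∈ I
    · simp [hz j hj]
    · simp [hI i j hi hj]
  have hform := hvanish _ hUe
  have hform2 : star (U *ᵥ e) ⬝ᵥ (conjDiagonal U x *ᵥ (U *ᵥ e)) =
      ∑ k, ((x k * normSq (e k) : ℝ) : ℂ) := by
    have h := conjTranspose_mul_self_eq_one hU
    rw [conjDiagonal, mulVec_mulVec, Matrix.mul_assoc, h, Matrix.mul_one, ← mulVec_mulVec,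
      star_mulVec, ← dotProduct_mulVec, mulVec_mulVec, h, one_mulVec]
    refine Finset.sum_congr rfl fun k _ => ?_
    rw [mulVec_diagonal, Pi.star_apply, RCLike.star_def]
    push_cast
    rw [normSq_eq_conj_mul_self]
    ring
  rw [hform2, ← ofReal_sum, ofReal_eq_zero] at hform
  have hnonneg : ∀ k ∈ Finset.univ, 0 ≤ x k * normSq (e k) := by
    intro k _
    by_cases hk : k ∈ K
    · exact mul_nonneg (hK k hk).le (normSq_nonneg _)
    · simp [e, hk]
  rw [Finset.sum_eq_zero_iff_of_nonneg hnonneg] at hform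
  refine hc0 (funext fun k => ?_)
  have h1 := hform k.1 (Finset.mem_univ _)
  have h2 := (mul_eq_zero.mp h1).resolve_left (hK k.1 k.2).ne'
  simpa [e] using h2

end UnitaryConjugation

section TraceInequality

variable {n : Type*} [Fintype n] [DecidableEq n]

lemma sum_mul_doublyStochastic_le {x y : n → ℝ} (hxy : Monovary x y)
    {D : Matrix n n ℝ} (hD : D ∈ doublyStochastic ℝ n) :
    ∑ i, ∑ j, x i * y j * D i j ≤ ∑ i, x i * y i := by
  obtain ⟨w, hw0, hw1, rfl⟩ := exists_eq_sum_perm_of_mem_doublyStochastic hD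
  calc ∑ i, ∑ j, x i * y j * (∑ σ : Equiv.Perm n, w σ • σ.permMatrix ℝ) i j
      = ∑ σ : Equiv.Perm n, w σ * ∑ i, x i * y (σ i) := by
        simp only [Matrix.sum_apply, Matrix.smul_apply, smul_eq_mul, Finset.mul_sum]
        rw [Finset.sum_comm (s := (Finset.univ : Finset (Equiv.Perm n)))]
        refine Finset.sum_congr rfl fun i _ => ?_
        rw [Finset.sum_comm]
        refine Finset.sum_congr rfl fun σ _ => ?_
        rw [Finset.sum_eq_single (σ i)]
        · simp only [PEquiv.toMatrix_apply, Equiv.toPEquiv_apply, Option.mem_some_iff, if_true]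
          ring
        · intro j _ hj
          simp [Equiv.toPEquiv_apply, hj.symm]
        · simp
    _ ≤ ∑ σ : Equiv.Perm n, w σ * ∑ i, x i * y i :=
        Finset.sum_le_sum fun σ _ => mul_le_mul_of_nonneg_left
          hxy.sum_mul_comp_perm_le_sum_mul (hw0 σ)
    _ = ∑ i, x i * y i := by rw [← Finset.sum_mul, hw1, one_mul]

/-- Von Neumann's trace inequality for Hermitian matrices. -/
lemma re_trace_conjDiagonal_mul_le {U V : Matrix n n ℂ} (hU : U * Uᴴ = 1) (hV : V * Vᴴ = 1)
    {x y : n → ℝ} (hxy : Monovary x y) :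
    ((conjDiagonal U x * conjDiagonal V y).trace).re ≤ ∑ i, x i * y i := by
  have hQ : (Uᴴ * V) * (Uᴴ * V)ᴴ = 1 := mul_mul_conjTranspose_self
    (by rw [conjTranspose_conjTranspose]; exact conjTranspose_mul_self_eq_one hU) hV
  refine le_trans (le_of_eq ?_)
    (sum_mul_doublyStochastic_le hxy (unistochastic_mem_doublyStochastic hQ))
  have h : (conjDiagonal U x * conjDiagonal V y).trace =
      (diagonal (fun i => (x i : ℂ)) * (Uᴴ * V) *
        (diagonal (fun i => (y i : ℂ)) * (Uᴴ * V)ᴴ)).trace := by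
    rw [conjTranspose_mul, conjTranspose_conjTranspose, conjDiagonal, conjDiagonal,
      Matrix.mul_assoc U, Matrix.mul_assoc U, trace_mul_comm U]
    simp only [Matrix.mul_assoc]
  rw [h, trace, re_sum]
  refine Finset.sum_congr rfl fun i _ => ?_
  rw [diag_apply, mul_apply, re_sum]
  refine Finset.sum_congr rfl fun j _ => ?_
  rw [diagonal_mul, diagonal_mul, conjTranspose_apply, RCLike.star_def, of_apply]
  simp only [normSq_apply, mul_re, mul_im, ofReal_re, ofReal_im, conj_re, conj_im]
  ring

end TraceInequality

/-- Every Hermitian matrix is unitarily diagonalizable with eigenvalues in increasing order. -/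
lemma Matrix.IsHermitian.exists_eq_conjDiagonal {d : ℕ} {A : Matrix (Fin d) (Fin d) ℂ}
    (hA : A.IsHermitian) :
    ∃ (U : Matrix (Fin d) (Fin d) ℂ) (x : Fin d → ℝ),
      U * Uᴴ = 1 ∧ Monotone x ∧ A = conjDiagonal U x := by
  let U : Matrix (Fin d) (Fin d) ℂ := hA.eigenvectorUnitary
  have hU : U * Uᴴ = 1 := Unitary.coe_mul_star_self hA.eigenvectorUnitary
  refine ⟨U.submatrix id (Tuple.sort hA.eigenvalues), hA.eigenvalues ∘ Tuple.sort hA.eigenvalues,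
    submatrix_mul_conjTranspose hU _, Tuple.monotone_sort _, ?_⟩
  rw [conjDiagonal_reindex]
  exact hA.spectral_theorem

section Crossing

/-- One of the two indices is at most `a` and the other one exceeds `b`. -/
abbrev Crosses (a b i j : ℕ) : Prop := (i ≤ a ∧ b < j) ∨ (j ≤ a ∧ b < i)

lemma sq_sub_eq_sum_crosses (f : ℕ → ℝ) {d i j : ℕ} (hi : i < d) (hj : j < d) :
    (f i - f j) ^ 2 = ∑ m ∈ Finset.range d, ∑ n ∈ Finset.range d,
      (f (m + 1) - f m) * (f (n + 1) - f n) *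
        (if Crosses (min m n) (max m n) i j then 1 else 0) := by
  wlog hij : i ≤ j generalizing i j
  · rw [← neg_sub, neg_sq, this hj hi (le_of_not_ge hij)]
    simp only [Crosses, or_comm]
  have h : f j - f i =
      ∑ m ∈ Finset.range d, (f (m + 1) - f m) * (if i ≤ m ∧ m < j then 1 else 0) := by
    rw [← Finset.sum_Ico_sub f hij]
    simp only [mul_ite, mul_one, mul_zero]
    rw [← Finset.sum_filter]
    refine Finset.sum_congr ?_ fun _ _ => rfl
    ext m
    simp only [Finset.mem_Ico, Finset.mem_filter, Finset.mem_range]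
    omega
  rw [← neg_sub, neg_sq, h, sq, Finset.sum_mul_sum]
  refine Finset.sum_congr rfl fun m _ => Finset.sum_congr rfl fun n _ => ?_
  have hc : Crosses (min m n) (max m n) i j ↔ (i ≤ m ∧ m < j) ∧ (i ≤ n ∧ n < j) := by
    simp only [Crosses]
    omega
  simp only [hc]
  by_cases h1 : i ≤ m ∧ m < j <;> by_cases h2 : i ≤ n ∧ n < j <;> simp [h1, h2]

lemma Monotone.exists_nat_extension {d : ℕ} {x : Fin d → ℝ} (hx : Monotone x) :
    ∃ f : ℕ → ℝ, Monotone f ∧ ∀ i : Fin d, f i = x i := by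
  rcases Nat.eq_zero_or_pos d with rfl | hd
  · exact ⟨fun _ => 0, monotone_const, fun i => i.elim0⟩
  · refine ⟨fun n => x ⟨min n (d - 1), by omega⟩, fun m n hmn => hx ?_, fun i => ?_⟩
    · exact Fin.mk_le_mk.mpr (min_le_min_right _ hmn)
    · have : min (i : ℕ) (d - 1) = i := by omega
      simp only [this]

/-- Weighted sums with weights `(x i - x j) ^ 2`, `x` monotone, are controlled by the sums over
all crossing regions. -/
lemma sum_sq_sub_mul_le_of_crosses {d : ℕ} {x : Fin d → ℝ} (hx : Monotone x)
    {u t : Fin d → Fin d → ℝ}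
    (hut : ∀ a b : ℕ, a ≤ b → ∑ i : Fin d, ∑ j : Fin d, (if Crosses a b i j then u i j else 0) ≤
      ∑ i : Fin d, ∑ j : Fin d, (if Crosses a b i j then t i j else 0)) :
    ∑ i, ∑ j, (x i - x j) ^ 2 * u i j ≤ ∑ i, ∑ j, (x i - x j) ^ 2 * t i j := by
  obtain ⟨f, hf, hfx⟩ := hx.exists_nat_extension
  have key : ∀ v : Fin d → Fin d → ℝ, ∑ i, ∑ j, (x i - x j) ^ 2 * v i j =
      ∑ m ∈ Finset.range d, ∑ n ∈ Finset.range d, (f (m + 1) - f m) * (f (n + 1) - f n) *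
        ∑ i : Fin d, ∑ j : Fin d,
          (if Crosses (min m n) (max m n) i j then v i j else 0) := by
    intro v
    simp only [← hfx, sq_sub_eq_sum_crosses f (Fin.is_lt _) (Fin.is_lt _), Finset.sum_mul,
      Finset.mul_sum]
    simp only [Finset.sum_comm (s := (Finset.univ : Finset (Fin d))) (t := Finset.range d)]
    refine Finset.sum_congr rfl fun m _ => Finset.sum_congr rfl fun n _ =>
      Finset.sum_congr rfl fun i _ => Finset.sum_congr rfl fun j _ => ?_
    split_ifs <;> ring
  rw [key, key]
  refine Finset.sum_le_sum fun m _ => Finset.sum_le_sum fun n _ => ?_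
  exact mul_le_mul_of_nonneg_left (hut _ _ min_le_max)
    (mul_nonneg (sub_nonneg.mpr (hf m.le_succ)) (sub_nonneg.mpr (hf n.le_succ)))

/-- A Bloomfield-Watson type bound for the off-diagonal blocks of a Hermitian matrix with
prescribed eigenvalues. -/
lemma sum_crosses_normSq_le {d : ℕ} {U : Matrix (Fin d) (Fin d) ℂ} (hU : U * Uᴴ = 1)
    {y : Fin d → ℝ} (hy : Monotone y) {a b : ℕ} (hab : a ≤ b) :
    ∑ i : Fin d, ∑ j : Fin d,
        (if Crosses a b i j then normSq (conjDiagonal U y i j) else 0) ≤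
      ∑ i : Fin d, ∑ j : Fin d,
        (if Crosses a b i j then (if j = i.rev then (y i - y j) ^ 2 / 4 else 0) else 0) := by
  set M := conjDiagonal U y with hM
  have hMH : M.IsHermitian := isHermitian_conjDiagonal U y
  let X : Matrix (Fin d) (Fin d) ℂ := .of fun i j => if Crosses a b i j then M i j else 0
  have hXapp : ∀ i j : Fin d, X i j = if Crosses a b i j then M i j else 0 := fun _ _ => rfl
  have hXH : X.IsHermitian := by
    ext i j
    rw [conjTranspose_apply, hXapp, hXapp, ← hMH.apply i j]
    simp only [Crosses, or_comm]
    split_ifs <;> simp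
  set T := ∑ i : Fin d, ∑ j : Fin d, (if Crosses a b i j then normSq (M i j) else 0)
  have hXX : ((X * X).trace).re = T := by
    rw [hXH.re_trace_mul_self]
    refine Finset.sum_congr rfl fun i _ => Finset.sum_congr rfl fun j _ => ?_
    rw [hXapp]
    split_ifs <;> simp
  have hXM : (X * M).trace = (X * X).trace := by
    simp only [trace, diag_apply, mul_apply]
    refine Finset.sum_congr rfl fun i _ => Finset.sum_congr rfl fun j _ => ?_
    rw [hXapp, hXapp]
    have : Crosses a b i j ↔ Crosses a b j i := or_comm
    by_cases h : Crosses a b i j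
    · rw [if_pos h, if_pos (this.mp h)]
    · rw [if_neg h, zero_mul, zero_mul]
  obtain ⟨W, x, hW, hx, hXW⟩ := hXH.exists_eq_conjDiagonal
  have hTx : T = ∑ i, x i ^ 2 := by
    rw [← hXX, hXW, trace_conjDiagonal_mul_self hW, re_sum]
    refine Finset.sum_congr rfl fun i _ => ?_
    rw [← ofReal_mul, ofReal_re, sq]
  have hupper : T ≤ ∑ i, x i * y i := by
    rw [← hXX, ← hXM, hM]
    nth_rewrite 1 [hXW]
    exact re_trace_conjDiagonal_mul_le hW hU (hx.monovary hy)
  -- The sign flip of the indices above `b` conjugates `X` to `-X`.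
  let S : Matrix (Fin d) (Fin d) ℂ := diagonal fun i => if b < (i : ℕ) then 1 else -1
  have hSH : Sᴴ = S := by
    rw [diagonal_conjTranspose]
    congr 1
    ext i
    rw [Pi.star_apply]
    split_ifs <;> simp
  have hS : S * Sᴴ = 1 := by
    rw [hSH, diagonal_mul_diagonal, ← diagonal_one]
    congr 1
    ext i
    split_ifs <;> simp
  have hSX : S * X * Sᴴ = -X := by
    ext i j
    rw [hSH, mul_diagonal, diagonal_mul, neg_apply, hXapp]
    by_cases h : Crosses a b i j
    · rw [if_pos h]
      rcases h with h | h
      · rw [if_neg (by omega), if_pos h.2]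
        ring
      · rw [if_pos h.2, if_neg (by omega)]
        ring
    · simp [h]
  have hXneg : X = conjDiagonal ((S * W).submatrix id Fin.revPerm)
      ((fun i => -x i) ∘ Fin.revPerm) := by
    rw [conjDiagonal_reindex, conjDiagonal_neg, ← mul_conjDiagonal_mul_conjTranspose, ← hXW, hSX,
      neg_neg]
  have hupper' : T ≤ ∑ i, -(x i * y i.rev) := by
    have hmono : Monotone ((fun i => -x i) ∘ Fin.revPerm) := fun i j hij =>
      neg_le_neg (hx (Fin.rev_le_rev.mpr hij))
    have h := re_trace_conjDiagonal_mul_le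
      (submatrix_mul_conjTranspose (mul_mul_conjTranspose_self hS hW) Fin.revPerm) hU
      (hmono.monovary hy)
    rw [← hXneg, ← hM, hXM, hXX] at h
    refine h.trans_eq ?_
    rw [← Equiv.sum_comp Fin.revPerm]
    refine Finset.sum_congr rfl fun i _ => ?_
    simp
  have hXzero : ∀ i j : Fin d, ¬ Crosses a b i j → X i j = 0 := fun i j h => if_neg h
  have hsupp : ∀ k : Fin d, ¬ Crosses a b k k.rev → x k = 0 := by
    intro k hk
    have hrev := Fin.val_rev k
    have hkd := k.isLt
    by_contra hxk
    have hcardle : ∀ m : ℕ,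
        ((Finset.univ : Finset (Fin d)).filter (fun i : Fin d => (i : ℕ) ≤ m)).card ≤ m + 1 := by
      intro m
      rw [← Finset.card_range (m + 1)]
      refine Finset.card_le_card_of_injOn Fin.val (fun i hi => ?_) Fin.val_injective.injOn
      simp only [Finset.coe_filter, Finset.mem_univ, true_and, Set.mem_ofPred_eq] at hi
      simp only [Finset.coe_range, Set.mem_Iio]
      omega
    have hcardgt : ((Finset.univ : Finset (Fin d)).filter (fun i : Fin d => b < (i : ℕ))).card
        ≤ d - 1 - b := by
      have hIoo : (Finset.Ioo b d).card = d - 1 - b := by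
        rw [Nat.card_Ioo]
        omega
      rw [← hIoo]
      refine Finset.card_le_card_of_injOn Fin.val (fun i hi => ?_) Fin.val_injective.injOn
      simp only [Finset.coe_filter, Finset.mem_univ, true_and, Set.mem_ofPred_eq] at hi
      simp only [Finset.coe_Ioo, Set.mem_Ioo]
      exact ⟨hi, i.isLt⟩
    have hle : ∀ (V : Matrix (Fin d) (Fin d) ℂ) (z : Fin d → ℝ) (K : Finset (Fin d)),
        V * Vᴴ = 1 → (∀ i j, X i j = 0 → conjDiagonal V z i j = 0) → (∀ i ∈ K, 0 < z i) →
        K.card ≤ a + 1 ∧ K.card ≤ d - 1 - b := by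
      intro V z K hV hz hK
      constructor
      · refine (card_le_card_of_conjDiagonal_pos hV z _ K (fun i j hi hj => ?_) hK).trans
          (hcardle a)
        simp only [Finset.mem_filter, Finset.mem_univ, true_and] at hi hj
        exact hz i j (hXzero i j (by simp only [Crosses]; omega))
      · refine (card_le_card_of_conjDiagonal_pos hV z _ K (fun i j hi hj => ?_) hK).trans
          hcardgt
        simp only [Finset.mem_filter, Finset.mem_univ, true_and] at hi hj
        exact hz i j (hXzero i j (by simp only [Crosses]; omega))
    rcases lt_or_gt_of_ne hxk with hneg | hpos
    · have h := hle W (fun i => -x i) (Finset.Iic k) hW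
        (fun i j h => by rw [conjDiagonal_neg, ← hXW, Matrix.neg_apply, h, neg_zero])
        (fun i hi => neg_pos.mpr ((hx (Finset.mem_Iic.mp hi)).trans_lt hneg))
      rw [Fin.card_Iic] at h
      apply hk
      simp only [Crosses]
      omega
    · have h := hle W x (Finset.Ici k) hW (fun i j h => by rw [← hXW, h])
        (fun i hi => hpos.trans_le (hx (Finset.mem_Ici.mp hi)))
      rw [Fin.card_Ici] at h
      apply hk
      simp only [Crosses]
      omega
  have hrhs : ∑ i : Fin d, ∑ j : Fin d,
      (if Crosses a b i j then (if j = i.rev then (y i - y j) ^ 2 / 4 else 0) else 0) =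
      ∑ i : Fin d, if Crosses a b i i.rev then (y i - y i.rev) ^ 2 / 4 else 0 := by
    refine Finset.sum_congr rfl fun i _ => ?_
    rw [Finset.sum_eq_single i.rev]
    · rw [if_pos rfl]
    · intro j _ hj
      rw [if_neg hj, ite_self]
    · simp
  rw [hrhs]
  have hpoint : ∑ i, (x i * y i - x i * y i.rev - x i ^ 2) ≤
      ∑ i : Fin d, if Crosses a b i i.rev then (y i - y i.rev) ^ 2 / 4 else 0 := by
    refine Finset.sum_le_sum fun i _ => ?_
    split_ifs with h
    · nlinarith [sq_nonneg (x i - (y i - y i.rev) / 2)]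
    · simp [hsupp i h]
  rw [Finset.sum_sub_distrib, Finset.sum_sub_distrib, ← hTx] at hpoint
  rw [Finset.sum_neg_distrib] at hupper'
  linarith

/-- Among all matrices with eigenvalues `y`, the weighted sum of squared moduli of the entries with
weights `(x i - x j) ^ 2` is bounded by its value on an antidiagonal pairing. -/
lemma sum_sq_sub_mul_normSq_conjDiagonal_le {d : ℕ} {U : Matrix (Fin d) (Fin d) ℂ}
    (hU : U * Uᴴ = 1) {x y : Fin d → ℝ} (hx : Monotone x) (hy : Monotone y) :
    ∑ i, ∑ j, (x i - x j) ^ 2 * normSq (conjDiagonal U y i j) ≤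
      ∑ i, ∑ j, (x i - x j) ^ 2 * (if j = i.rev then (y i - y j) ^ 2 / 4 else 0) :=
  sum_sq_sub_mul_le_of_crosses hx fun _ _ hab => sum_crosses_normSq_le hU hy hab

end Crossing

section ReversalMixing

/-- The unitary `(1 + I • J) / √2`, where `J` is the reversal permutation matrix. -/
noncomputable def reversalMixing (d : ℕ) : Matrix (Fin d) (Fin d) ℂ :=
  .of fun i j => ((√2)⁻¹ : ℝ) * ((if i = j then 1 else 0) + (if i.rev = j then I else 0))

lemma conjDiagonal_reversalMixing_apply {d : ℕ} (x : Fin d → ℝ) (i j : Fin d) :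
    conjDiagonal (reversalMixing d) x i j =
      ((if i = j then (x i + x i.rev : ℂ) else 0) +
        (if j = i.rev then I * (x i.rev - x i) else 0)) / 2 := by
  have hs : (((√2)⁻¹ : ℝ) : ℂ) * ((√2)⁻¹ : ℝ) = 1 / 2 := by
    rw [← ofReal_mul, ← mul_inv, Real.mul_self_sqrt (by norm_num)]
    norm_num
  have hterm : ∀ k : Fin d, (reversalMixing d * diagonal (fun i => (x i : ℂ))) i k *
      (reversalMixing d)ᴴ k j = 1 / 2 * ((if i = k then x k *
        ((if j = k then 1 else 0) - (if j.rev = k then I else 0)) else 0) +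
        (if i.rev = k then I * x k *
        ((if j = k then 1 else 0) - (if j.rev = k then I else 0)) else 0)) := by
    intro k
    rw [mul_diagonal, conjTranspose_apply, reversalMixing, of_apply, of_apply, ← hs]
    simp only [RCLike.star_def, map_mul, map_add, conj_ofReal, apply_ite (starRingEnd ℂ), map_one,
      map_zero, conj_I]
    split_ifs <;> ring
  rw [conjDiagonal, mul_apply, Finset.sum_congr rfl fun k _ => hterm k, ← Finset.mul_sum,
    Finset.sum_add_distrib, Finset.sum_ite_eq, Finset.sum_ite_eq]
  have h1 : (j = i) = (i = j) := propext eq_comm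
  have h2 : (j.rev = i) = (j = i.rev) := propext Fin.rev_eq_iff
  have h3 : (j.rev = i.rev) = (i = j) := by rw [Fin.rev_inj, h1]
  simp only [Finset.mem_univ, if_true, h1, h2, h3]
  split_ifs <;> ring_nf <;> simp <;> ring

lemma reversalMixing_mul_conjTranspose (d : ℕ) :
    reversalMixing d * (reversalMixing d)ᴴ = 1 := by
  have h : conjDiagonal (reversalMixing d) (fun _ => 1) =
      reversalMixing d * (reversalMixing d)ᴴ := by
    simp [conjDiagonal]
  rw [← h]
  ext i j
  rw [conjDiagonal_reversalMixing_apply, one_apply]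
  split_ifs <;> norm_num

end ReversalMixing

/-- For a real diagonal Hamiltonian with nondecreasing energies and
any purity `κ ∈ [1/d, 1]`, the squared speed over density matrices of purity `κ` is
maximized on a persymmetric X-state: for every density matrix `ρ` of purity `κ` there
is a density matrix `σ` of the same purity, vanishing off the main and secondary
diagonals and symmetric w.r.t. the secondary diagonal, with at least the same speed. -/
theorem optimal_state_is_persymmetric_X {d : ℕ} (E : Fin d → ℝ) (hE : Monotone E)
    (H : Matrix (Fin d) (Fin d) ℂ)
    (hH : H = Matrix.diagonal fun i => (E i : ℂ))
    (κ : ℝ) (hκ : κ ∈ Set.Icc (1 / (d : ℝ)) 1)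
    (ρ : Matrix (Fin d) (Fin d) ℂ)
    (hρ : ρ.PosSemidef) (hTrρ : ρ.trace = 1) (hpurρ : (ρ * ρ).trace = (κ : ℂ)) :
    ∃ σ : Matrix (Fin d) (Fin d) ℂ,
      σ.PosSemidef ∧ σ.trace = 1 ∧ (σ * σ).trace = (κ : ℂ)
      ∧ (∀ i j : Fin d, i ≠ j → j ≠ i.rev → σ i j = 0)
      ∧ (∀ i j : Fin d, σ i j = σ j.rev i.rev)
      ∧ (-(((H * ρ - ρ * H) * (H * ρ - ρ * H)).trace)).re
          ≤ (-(((H * σ - σ * H) * (H * σ - σ * H)).trace)).re := by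
  subst hH
  obtain ⟨U, x, hU, hx, rfl⟩ := hρ.isHermitian.exists_eq_conjDiagonal
  have hxnonneg : ∀ i, 0 ≤ x i := by
    have h := hρ.conjTranspose_mul_mul_same U
    have hU' := conjTranspose_mul_self_eq_one hU
    rw [conjDiagonal, ← Matrix.mul_assoc, ← Matrix.mul_assoc, hU', Matrix.one_mul,
      Matrix.mul_assoc, hU', Matrix.mul_one, posSemidef_diagonal_iff] at h
    exact fun i => Complex.zero_le_real.mp (h i)
  have hA := reversalMixing_mul_conjTranspose d
  refine ⟨conjDiagonal (reversalMixing d) x, posSemidef_conjDiagonal _ hxnonneg, ?_, ?_, ?_,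
    ?_, ?_⟩
  · rw [trace_conjDiagonal hA, ← hTrρ, trace_conjDiagonal hU]
  · rw [trace_conjDiagonal_mul_self hA, ← hpurρ, trace_conjDiagonal_mul_self hU]
  · intro i j hij hj
    rw [conjDiagonal_reversalMixing_apply, if_neg hij, if_neg hj]
    simp
  · intro i j
    rw [conjDiagonal_reversalMixing_apply, conjDiagonal_reversalMixing_apply, Fin.rev_rev]
    have h1 : (j.rev = i.rev) = (i = j) := by rw [Fin.rev_inj]; exact propext eq_comm
    have h2 : (i.rev = j) = (j = i.rev) := propext eq_comm
    simp only [h1, h2]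
    congr 2
    · split_ifs with h
      · rw [h, add_comm]
      · rfl
    · split_ifs with h
      · rw [h, Fin.rev_rev]
      · rfl
  · rw [(isHermitian_conjDiagonal U x).neg_trace_commutator_sq,
      (isHermitian_conjDiagonal (reversalMixing d) x).neg_trace_commutator_sq]
    refine (sum_sq_sub_mul_normSq_conjDiagonal_le hU hE hx).trans_eq ?_
    refine Finset.sum_congr rfl fun i _ => Finset.sum_congr rfl fun j _ => ?_
    rcases eq_or_ne i j with rfl | hij
    · simp
    · rw [conjDiagonal_reversalMixing_apply, if_neg hij]
      split_ifs with hj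
      · subst hj
        congr 1
        rw [zero_add, ← ofReal_sub, normSq_div, normSq_mul, normSq_I, normSq_ofReal]
        norm_num
        ring
      · simp
end

section
/- Let d ≥ 3, let H = diag(E₁,…,E_d) with E₁ ≤ ⋯ ≤ E_d, let κ ∈ [1/d + 2/d², 1], θ ∈ ℝ, and set x := (d−2)/(2d(d−1)) · (−1 + d·√((−1 + (d−1)κ)/(d−2))). Let Ψ₁ := (e₁ + e^{−iθ}e_d)/√2 and define ρ_κ := 2(1/d + x)·|Ψ₁⟩⟨Ψ₁| + (1/d − 2x/(d−2))·Σ_{i=2}^{d−1} |e_i⟩⟨e_i|. Then x ∈ [0, (d−2)/(2d)], ρ_κ is a density matrix with Tr(ρ_κ²) = κ, and −Tr([H,ρ_κ]²) = 2(1/d + x)²(E_d − E₁)². -/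
open Matrix Complex
open scoped ComplexOrder

/-- Expectation of a diagonal observable in the vector with amplitudes `α`, `β` at `p`, `q`. -/
theorem star_dotProduct_two_level {n : Type*} [Fintype n] [DecidableEq n] {p q : n} (hpq : p ≠ q)
    (α β : ℂ) (f : n → ℂ) :
    star (Pi.single p α + Pi.single q β : n → ℂ) ⬝ᵥ
        (Matrix.diagonal f *ᵥ (Pi.single p α + Pi.single q β : n → ℂ))
      = f p * (α * star α) + f q * (β * star β) := by
  rw [Matrix.mulVec_add, dotProduct_add, Matrix.diagonal_mulVec_single,
    Matrix.diagonal_mulVec_single, dotProduct_single, dotProduct_single]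
  simp [hpq, hpq.symm]
  ring

/-- `Tr([H, P]²) = 2⟨H⟩² - 2⟨H²⟩` for the rank-one projection `P = |u⟩⟨v|`. -/
theorem trace_commutator_sq_vecMulVec {n : Type*} [Fintype n] [DecidableEq n]
    (H : Matrix n n ℂ) (u v : n → ℂ) (huv : v ⬝ᵥ u = 1) :
    ((H * vecMulVec u v - vecMulVec u v * H) * (H * vecMulVec u v - vecMulVec u v * H)).trace
      = 2 * (v ⬝ᵥ (H *ᵥ u)) ^ 2 - 2 * (v ⬝ᵥ ((H * H) *ᵥ u)) := by
  have hPP : vecMulVec u v * vecMulVec u v = vecMulVec u v := by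
    rw [vecMulVec_mul_vecMulVec, huv, one_smul]
  have htr : ∀ A : Matrix n n ℂ, (A * vecMulVec u v).trace = v ⬝ᵥ (A *ᵥ u) := fun A => by
    rw [mul_vecMulVec, trace_vecMulVec, dotProduct_comm]
  generalize hP : vecMulVec u v = P at *
  have hexp : (H * P - P * H) * (H * P - P * H)
      = H * P * (H * P) - H * (P * P) * H - P * (H * H * P) + P * H * (P * H) := by
    noncomm_ring
  have hPHP : (H * P * (H * P)).trace = (v ⬝ᵥ (H *ᵥ u)) ^ 2 := by
    rw [← mul_assoc, htr, ← hP, mul_assoc, ← mulVec_mulVec, ← mulVec_mulVec,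
      vecMulVec_mulVec, mulVec_smul, dotProduct_smul]
    simp [pow_two]
  have hPHP' : (P * H * (P * H)).trace = (v ⬝ᵥ (H *ᵥ u)) ^ 2 := by
    rw [← hPHP, mul_assoc P, trace_mul_comm P]
    simp only [mul_assoc]
  have h1 : (H * P * H).trace = v ⬝ᵥ ((H * H) *ᵥ u) := by
    rw [trace_mul_comm, ← mul_assoc, htr]
  have h2 : (P * (H * H * P)).trace = v ⬝ᵥ ((H * H) *ᵥ u) := by
    rw [trace_mul_comm, mul_assoc, hPP, htr]
  rw [hexp, hPP, trace_add, trace_sub, trace_sub, hPHP, hPHP', h1, h2]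
  ring

/-- Range of the optimal parameter `x`, and the purity of the spectrum it determines. -/
theorem optimal_parameter_bounds {d κ x : ℝ} (hd : 3 ≤ d)
    (hκ : κ ∈ Set.Icc (1 / d + 2 / d ^ 2) 1)
    (hx : x = (d - 2) / (2 * d * (d - 1)) * (-1 + d * Real.sqrt ((-1 + (d - 1) * κ) / (d - 2)))) :
    x ∈ Set.Icc 0 ((d - 2) / (2 * d)) ∧
      (2 * (1 / d + x)) ^ 2 + (d - 2) * (1 / d - 2 * x / (d - 2)) ^ 2 = κ := by
  obtain ⟨hl, hu⟩ := hκ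
  have hd0 : 0 < d := by linarith
  have hd1 : 0 < d - 1 := by linarith
  have hd2 : 0 < d - 2 := by linarith
  have hlow : (1 / d) ^ 2 ≤ (-1 + (d - 1) * κ) / (d - 2) := by
    rw [le_div_iff₀ hd2]
    have h := mul_le_mul_of_nonneg_left hl hd1.le
    have : (d - 1) * (1 / d + 2 / d ^ 2) = 1 + (1 / d) ^ 2 * (d - 2) := by field_simp; ring
    linarith
  have hup : (-1 + (d - 1) * κ) / (d - 2) ≤ 1 := by
    rw [div_le_one hd2]
    nlinarith
  have hs2 := Real.sq_sqrt ((sq_nonneg _).trans hlow)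
  have hs0 := Real.le_sqrt_of_sq_le hlow
  have hs1 := Real.sqrt_le_one.2 hup
  generalize Real.sqrt ((-1 + (d - 1) * κ) / (d - 2)) = s at *
  have hds : 1 ≤ d * s := by
    rwa [div_le_iff₀' hd0] at hs0
  have hκs : κ = (1 + (d - 2) * s ^ 2) / (d - 1) := by
    rw [hs2]; field_simp; ring
  refine ⟨⟨?_, ?_⟩, ?_⟩
  · rw [hx]
    exact mul_nonneg (by positivity) (by linarith)
  · have : (d - 2) / (2 * d) = (d - 2) / (2 * d * (d - 1)) * (d - 1) := by field_simp
    rw [hx, this]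
    exact mul_le_mul_of_nonneg_left (by nlinarith) (by positivity)
  · rw [hx, hκs]
    field_simp
    ring

/-- For `d ≥ 3`, nondecreasing energies, and purity
`κ ∈ [1/d + 2/d², 1]`, with `x = (d−2)/(2d(d−1))·(−1 + d√((−1+(d−1)κ)/(d−2)))`, the
state `ρ_κ = 2(1/d + x)|Ψ₁⟩⟨Ψ₁| + (1/d − 2x/(d−2))Σ_{i=2}^{d−1}|e_i⟩⟨e_i|`, where
`Ψ₁ = (e₁ + e^{−iθ}e_d)/√2`, satisfies `x ∈ [0, (d−2)/(2d)]`, is a density matrix of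
purity `κ`, and has squared speed `2(1/d + x)²(E_d − E₁)²`. -/
theorem optimal_state_high_purity {d : ℕ} (hd : 3 ≤ d)
    (E : Fin d → ℝ) (hE : Monotone E)
    (H : Matrix (Fin d) (Fin d) ℂ)
    (hH : H = Matrix.diagonal fun i => (E i : ℂ))
    (κ : ℝ) (hκ : κ ∈ Set.Icc (1 / (d : ℝ) + 2 / (d : ℝ)^2) 1)
    (θ : ℝ) (x : ℝ)
    (hx : x = ((d : ℝ) - 2) / (2 * d * ((d : ℝ) - 1))
        * (-1 + (d : ℝ) * Real.sqrt ((-1 + ((d : ℝ) - 1) * κ) / ((d : ℝ) - 2))))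
    (Ψ : Fin d → ℂ)
    (hΨ : Ψ = ((Real.sqrt 2 : ℂ))⁻¹ •
        ((Pi.single (⟨0, by omega⟩ : Fin d) 1 : Fin d → ℂ)
          + Complex.exp (-(θ : ℂ) * Complex.I) • (Pi.single (⟨d - 1, by omega⟩ : Fin d) 1 : Fin d → ℂ)))
    (ρκ : Matrix (Fin d) (Fin d) ℂ)
    (hρκ : ρκ = ((2 * (1 / (d : ℝ) + x) : ℝ) : ℂ) • Matrix.vecMulVec Ψ (star Ψ)
        + ((1 / (d : ℝ) - 2 * x / ((d : ℝ) - 2) : ℝ) : ℂ) •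
            Matrix.diagonal (fun i : Fin d =>
              if i = (⟨0, by omega⟩ : Fin d) ∨ i = (⟨d - 1, by omega⟩ : Fin d) then 0 else 1)) :
    x ∈ Set.Icc (0 : ℝ) (((d : ℝ) - 2) / (2 * d))
    ∧ ρκ.PosSemidef ∧ ρκ.trace = 1 ∧ (ρκ * ρκ).trace = (κ : ℂ)
    ∧ -(((H * ρκ - ρκ * H) * (H * ρκ - ρκ * H)).trace)
        = ((2 * (1 / (d : ℝ) + x)^2 * (E ⟨d - 1, by omega⟩ - E ⟨0, by omega⟩)^2 : ℝ) : ℂ) := by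
  obtain ⟨hxI, hpur⟩ := optimal_parameter_bounds (d := (d : ℝ)) (by exact_mod_cast hd) hκ hx
  refine ⟨hxI, ?_⟩
  have hd3 : (3 : ℝ) ≤ d := by exact_mod_cast hd
  have hd0 : (0 : ℝ) < d := by linarith
  have hd2 : (0 : ℝ) < (d : ℝ) - 2 := by linarith
  have ha : 0 ≤ 2 * (1 / (d : ℝ) + x) := by have := hxI.1; positivity
  have hb : 0 ≤ 1 / (d : ℝ) - 2 * x / ((d : ℝ) - 2) := by
    rw [sub_nonneg, div_le_iff₀ hd2]
    have := hxI.2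
    have h : ((d : ℝ) - 2) / (2 * d) = 1 / (d : ℝ) * ((d : ℝ) - 2) / 2 := by field_simp
    linarith
  have htot : 2 * (1 / (d : ℝ) + x)
      + ((d : ℝ) - 2) * (1 / (d : ℝ) - 2 * x / ((d : ℝ) - 2)) = 1 := by
    field_simp; ring
  have hspeed : 2 * (1 / (d : ℝ) + x) ^ 2 = (2 * (1 / (d : ℝ) + x)) ^ 2 / 2 := by ring
  rw [hspeed]
  generalize 2 * (1 / (d : ℝ) + x) = a at *
  generalize 1 / (d : ℝ) - 2 * x / ((d : ℝ) - 2) = b at *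
  have hpq : (⟨0, by omega⟩ : Fin d) ≠ ⟨d - 1, by omega⟩ := by
    rw [Ne, Fin.mk.injEq]; omega
  generalize (⟨0, by omega⟩ : Fin d) = p at *
  generalize (⟨d - 1, by omega⟩ : Fin d) = q at *
  obtain ⟨α, β, hα, hβ, hΨ'⟩ : ∃ α β : ℂ, α * star α = 1 / 2 ∧ β * star β = 1 / 2 ∧
      Ψ = Pi.single p α + Pi.single q β := by
    have h2 : ((Real.sqrt 2 : ℂ))⁻¹ * ((Real.sqrt 2 : ℂ))⁻¹ = 1 / 2 := by
      rw [← mul_inv, ← Complex.ofReal_mul, Real.mul_self_sqrt zero_le_two]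
      norm_num
    have hc : Complex.exp (-(θ : ℂ) * Complex.I) * star (Complex.exp (-(θ : ℂ) * Complex.I)) = 1 := by
      rw [Complex.star_def, ← Complex.exp_conj, ← Complex.exp_add]
      simp
    refine ⟨((Real.sqrt 2 : ℂ))⁻¹, ((Real.sqrt 2 : ℂ))⁻¹ * Complex.exp (-(θ : ℂ) * Complex.I),
      ?_, ?_, ?_⟩
    · simpa using h2
    · rw [star_mul', mul_mul_mul_comm, hc]
      simpa using h2
    · rw [hΨ, smul_add, smul_smul, ← Pi.single_smul, ← Pi.single_smul]
      simp
  have hexpect (f : Fin d → ℂ) :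
      star Ψ ⬝ᵥ (diagonal f *ᵥ Ψ) = f p * (1 / 2) + f q * (1 / 2) := by
    rw [hΨ', star_dotProduct_two_level hpq, hα, hβ]
  have hnorm : star Ψ ⬝ᵥ Ψ = 1 := by
    have := hexpect fun _ => 1
    rw [diagonal_one, one_mulVec] at this
    rw [this]; norm_num
  set D : Matrix (Fin d) (Fin d) ℂ := diagonal fun i => if i = p ∨ i = q then 0 else 1 with hD
  have hDΨ : D *ᵥ Ψ = 0 := by
    rw [hΨ', hD, mulVec_add, diagonal_mulVec_single, diagonal_mulVec_single]
    simp
  have hDD : D * D = D := by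
    rw [hD, diagonal_mul_diagonal]
    congr 1
    ext i
    split_ifs <;> simp
  have hDtr : D.trace = ((d : ℝ) - 2 : ℝ) := by
    have h : ∀ i : Fin d, (if i = p ∨ i = q then 0 else 1 : ℂ)
        = 1 - (if i = p then 1 else 0) - (if i = q then 1 else 0) := fun i => by
      rcases eq_or_ne i p with rfl | hp
      · simp [hpq]
      · rcases eq_or_ne i q with rfl | hq <;> simp [*]
    rw [hD, trace_diagonal, Finset.sum_congr rfl fun i _ => h i]
    simp [Finset.sum_sub_distrib]
    ring
  have hDH : H * D = D * H := by
    rw [hH, hD, diagonal_mul_diagonal, diagonal_mul_diagonal]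
    simp only [mul_comm]
  have hPtr : (vecMulVec Ψ (star Ψ)).trace = 1 := by
    rw [trace_vecMulVec, dotProduct_comm, hnorm]
  have hPP : vecMulVec Ψ (star Ψ) * vecMulVec Ψ (star Ψ) = vecMulVec Ψ (star Ψ) := by
    rw [vecMulVec_mul_vecMulVec, hnorm, one_smul]
  have hDP : D * vecMulVec Ψ (star Ψ) = 0 := by
    rw [mul_vecMulVec, hDΨ, zero_vecMulVec]
  refine ⟨?_, ?_, ?_, ?_⟩
  · rw [hρκ]
    refine ((posSemidef_vecMulVec_self_star Ψ).smul (Complex.zero_le_real.2 ha)).add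
      (PosSemidef.smul (PosSemidef.diagonal fun i => ?_) (Complex.zero_le_real.2 hb))
    dsimp only
    split_ifs <;> simp
  · rw [hρκ, trace_add, trace_smul, trace_smul, hPtr, hDtr, smul_eq_mul, smul_eq_mul, mul_one,
      mul_comm (b : ℂ)]
    exact_mod_cast htot
  · have hPDtr : (vecMulVec Ψ (star Ψ) * D).trace = 0 := by
      rw [trace_mul_comm, hDP, trace_zero]
    rw [hρκ, add_mul, mul_add, mul_add]
    simp only [smul_mul, Matrix.mul_smul, trace_add, trace_smul, hPP, hDD, hDP, hPDtr, hPtr, hDtr,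
      smul_eq_mul, trace_zero]
    rw [← hpur]
    push_cast
    ring
  · have hcomm : H * ρκ - ρκ * H
        = (a : ℂ) • (H * vecMulVec Ψ (star Ψ) - vecMulVec Ψ (star Ψ) * H) := by
      rw [hρκ, mul_add, add_mul, Matrix.mul_smul, Matrix.mul_smul, smul_mul, smul_mul,
        hDH, smul_sub]
      abel
    rw [hcomm, smul_mul, Matrix.mul_smul, trace_smul, trace_smul,
      trace_commutator_sq_vecMulVec H Ψ (star Ψ) hnorm, hH, diagonal_mul_diagonal,
      hexpect, hexpect, smul_eq_mul, smul_eq_mul]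
    push_cast
    ring
end

section
/- Let d ≥ 4, let H = diag(E₁,…,E_d) with E₁ < E₂ < ⋯ < E_d, and suppose γ₁ := (E_d − E₁)²/(E_{d−1} − E₂)² ≥ 2. Let κ ∈ [1/d + 2/d², 1] and set x := (d−2)/(2d(d−1)) · (−1 + d·√((−1 + (d−1)κ)/(d−2))). Then every density matrix σ ∈ M_d(ℂ) with Tr(σ²) = κ satisfies −Tr([H,σ]²) ≤ 2(1/d + x)²(E_d − E₁)², i.e., the state ρ_κ := 2(1/d+x)|Ψ₁⟩⟨Ψ₁| + (1/d − 2x/(d−2))Σ_{i=2}^{d−1}|e_i⟩⟨e_i| with Ψ₁ = (e₁ + e^{−iθ}e_d)/√2 is optimal among all density matrices of purity κ. -/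
open Matrix Complex
open scoped ComplexOrder

theorem trace_conjTranspose_mul_self_eq_sum_normSq {ι : Type*} [Fintype ι] (N : Matrix ι ι ℂ) :
    (Nᴴ * N).trace = ((∑ i, ∑ j, normSq (N i j) : ℝ) : ℂ) := by
  rw [Finset.sum_comm]
  simp only [Matrix.trace, Matrix.diag, Matrix.mul_apply, Matrix.conjTranspose_apply, ofReal_sum,
    normSq_eq_conj_mul_self, starRingEnd_apply]

theorem sum_normSq_ge_of_orthonormal_pair {ι : Type*} [Fintype ι] [DecidableEq ι]
    (N : Matrix ι ι ℂ) (u v : ι → ℂ) (huu : star u ⬝ᵥ u = 1) (hvv : star v ⬝ᵥ v = 1)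
    (huv : star u ⬝ᵥ v = 0) (hcard : 2 < Fintype.card ι) :
    (star u ⬝ᵥ N *ᵥ u).re ^ 2 + (star v ⬝ᵥ N *ᵥ v).re ^ 2
      + (N.trace.re - (star u ⬝ᵥ N *ᵥ u).re - (star v ⬝ᵥ N *ᵥ v).re) ^ 2
        / ((Fintype.card ι : ℝ) - 2) ≤ ∑ i, ∑ j, normSq (N i j) := by
  have hvu : star v ⬝ᵥ u = 0 := by
    have := congrArg star huv
    rwa [Matrix.star_dotProduct, star_star, star_zero] at this
  set q := (star u ⬝ᵥ N *ᵥ u).re with hq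
  set p := (star v ⬝ᵥ N *ᵥ v).re with hp
  set t := N.trace.re with ht
  have hc : (0 : ℝ) < (Fintype.card ι : ℝ) - 2 := by
    have : (2 : ℝ) < Fintype.card ι := by exact_mod_cast hcard
    linarith
  set c : ℝ := (Fintype.card ι : ℝ) - 2 with hcdef
  have hcc : (Fintype.card ι : ℂ) = (c : ℂ) + 2 := by rw [hcdef]; push_cast; ring
  set b : ℝ := (t - q - p) / c with hb
  have hbc : b * c = t - q - p := by rw [hb]; field_simp
  set X : Matrix ι ι ℂ := ((q - b : ℝ) : ℂ) • vecMulVec u (star u)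
    + ((p - b : ℝ) : ℂ) • vecMulVec v (star v) + (b : ℂ) • 1 with hX
  have hXH : Xᴴ = X := by
    simp [hX, Matrix.conjTranspose_add, Matrix.conjTranspose_smul, Matrix.conjTranspose_vecMulVec]
  have hXN : (X * N).trace = (q - b : ℝ) * (star u ⬝ᵥ N *ᵥ u)
      + (p - b : ℝ) * (star v ⬝ᵥ N *ᵥ v) + b * N.trace := by
    simp [hX, Matrix.add_mul, Matrix.trace_add, Matrix.vecMulVec_mul, Matrix.trace_vecMulVec,
      Matrix.dotProduct_mulVec, dotProduct_comm _ u, dotProduct_comm _ v]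
  have hXX : (X * X).trace = ((q ^ 2 + p ^ 2 + b ^ 2 * c : ℝ) : ℂ) := by
    have hu1 : u ⬝ᵥ star u = 1 := by rw [dotProduct_comm]; exact huu
    have hv1 : v ⬝ᵥ star v = 1 := by rw [dotProduct_comm]; exact hvv
    simp [hX, Matrix.add_mul, Matrix.mul_add, Matrix.trace_add, Matrix.vecMulVec_mul_vecMulVec,
      Matrix.trace_vecMulVec, huu, hvv, huv, hvu, hu1, hv1, hcc]
    ring
  have hNX : (Nᴴ * X).trace = star (X * N).trace := by
    rw [← Matrix.trace_conjTranspose, Matrix.conjTranspose_mul, hXH]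
  have hpos : 0 ≤ (((N - X)ᴴ * (N - X)).trace).re := by
    rw [trace_conjTranspose_mul_self_eq_sum_normSq, ofReal_re]
    exact Finset.sum_nonneg fun i _ => Finset.sum_nonneg fun j _ => normSq_nonneg _
  have hre : ((X * N).trace).re = (q - b) * q + (p - b) * p + b * t := by
    rw [hXN]; simp [hq, hp, ht]
  rw [Matrix.conjTranspose_sub, hXH, Matrix.sub_mul, Matrix.mul_sub, Matrix.mul_sub,
    Matrix.trace_sub, Matrix.trace_sub, Matrix.trace_sub, hNX, hXX,
    trace_conjTranspose_mul_self_eq_sum_normSq] at hpos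
  have hst : (star (X * N).trace).re = ((X * N).trace).re := by simp
  rw [sub_re, sub_re, sub_re, hst, hre, ofReal_re, ofReal_re] at hpos
  have : (t - q - p) ^ 2 / c = b ^ 2 * c := by rw [hb]; field_simp
  rw [this]
  nlinarith [congrArg (b * ·) hbc]

/-- Cauchy–Schwarz. -/
theorem Matrix.PosSemidef.normSq_dotProduct_mulVec_le {ι : Type*} [Fintype ι]
    {σ : Matrix ι ι ℂ} (hσ : σ.PosSemidef) (u v : ι → ℂ) :
    normSq (star u ⬝ᵥ σ *ᵥ v) ≤ (star u ⬝ᵥ σ *ᵥ u).re * (star v ⬝ᵥ σ *ᵥ v).re := by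
  have h := (hσ.conjTranspose_mul_mul_same (Matrix.of fun i (j : Fin 2) => ![u i, v i] j)).det_nonneg
  have key : ∀ a b : Fin 2, ((Matrix.of fun i (j : Fin 2) => ![u i, v i] j)ᴴ * σ *
      (Matrix.of fun i (j : Fin 2) => ![u i, v i] j)) a b
      = star (fun i => ![u i, v i] a) ⬝ᵥ σ *ᵥ (fun i => ![u i, v i] b) := by
    intro a b
    rw [Matrix.mul_assoc]
    simp only [Matrix.mul_apply, dotProduct, mulVec]
    rfl
  rw [Matrix.det_fin_two, key, key, key, key] at h
  simp only [Matrix.cons_val_zero, Matrix.cons_val_one] at h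
  have hc : star v ⬝ᵥ σ *ᵥ u = star (star u ⬝ᵥ σ *ᵥ v) := by
    rw [← Matrix.star_dotProduct_star, star_star, Matrix.star_mulVec, hσ.1.eq,
      Matrix.dotProduct_mulVec, dotProduct_comm]
  have him : ∀ w : ι → ℂ, (star w ⬝ᵥ σ *ᵥ w).im = 0 := fun w =>
    ((Complex.le_def.1 (hσ.dotProduct_mulVec_nonneg w)).2).symm
  have h2 := (Complex.le_def.1 h).1
  rw [hc] at h2
  simp [him] at h2
  rw [normSq_apply]
  linarith

theorem convexOn_sum_sq_sub_mul {ι : Type*} [Fintype ι] (w : ι → ι → ℝ) (hw : ∀ i j, 0 ≤ w i j) :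
    ConvexOn ℝ Set.univ fun t : ι → ℝ => ∑ i, ∑ j, (t i - t j) ^ 2 * w i j := by
  refine ⟨convex_univ, fun x _ y _ a b ha hb hab => ?_⟩
  simp only [Pi.add_apply, Pi.smul_apply, smul_eq_mul, Finset.mul_sum]
  rw [← Finset.sum_add_distrib]
  refine Finset.sum_le_sum fun i _ => ?_
  rw [← Finset.sum_add_distrib]
  refine Finset.sum_le_sum fun j _ => ?_
  have : a * ((x i - x j) ^ 2 * w i j) + b * ((y i - y j) ^ 2 * w i j)
      - (a * x i + b * y i - (a * x j + b * y j)) ^ 2 * w i j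
      = a * b * ((x i - x j) - (y i - y j)) ^ 2 * w i j := by
    obtain rfl : b = 1 - a := by linarith
    ring
  have h2 : 0 ≤ a * b * ((x i - x j) - (y i - y j)) ^ 2 * w i j :=
    mul_nonneg (by positivity) (hw i j)
  linarith

theorem ConvexOn.exists_ge_endpoints_of_mem_Icc {ι : Type*} [Finite ι] {f : (ι → ℝ) → ℝ}
    (hf : ConvexOn ℝ Set.univ f) {l u y : ι → ℝ} (hy : ∀ i, y i ∈ Set.Icc (l i) (u i)) :
    ∃ F : ι → ℝ, (∀ i, F i = l i ∨ F i = u i) ∧ f y ≤ f F := by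
  have hmem : y ∈ convexHull ℝ (Set.univ.pi fun i => ({l i, u i} : Set ℝ)) := by
    rw [convexHull_pi]
    intro i _
    simp only [convexHull_pair]
    rw [segment_eq_Icc ((hy i).1.trans (hy i).2)]
    exact hy i
  obtain ⟨F, hF, hle⟩ := (hf.subset (Set.subset_univ _)
    (convex_convexHull ℝ _)).exists_ge_of_mem_convexHull (subset_convexHull ℝ _) hmem
  exact ⟨F, fun i => by simpa using hF i (Set.mem_univ i), hle⟩

theorem speed_le_of_purity_bounds {n a κ v s P : ℝ} (hn : 0 < n)
    (ha : 2 / (n + 2) ≤ 2 * a) (ha1 : 2 * a ≤ 1)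
    (hκ : 4 * a ^ 2 + (1 - 2 * a) ^ 2 / n = κ) (hP : 0 ≤ P)
    (hv : v ≤ (κ - P - (1 - s) ^ 2 / n) / 2) (hs : s ^ 2 - P + (1 - s) ^ 2 / n ≤ κ) :
    v ≤ 2 * a ^ 2 := by
  by_contra! hlt
  have h1 : n * P + (1 - s) ^ 2 < (1 - 2 * a) ^ 2 := by
    have : P + (1 - s) ^ 2 / n < (1 - 2 * a) ^ 2 / n := by linarith
    rw [lt_div_iff₀ hn, add_mul, div_mul_cancel₀ _ hn.ne'] at this
    linarith
  have h2 : n * (s ^ 2 - P) + (1 - s) ^ 2 ≤ n * (4 * a ^ 2) + (1 - 2 * a) ^ 2 := by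
    have := mul_le_mul_of_nonneg_left (hs.trans hκ.ge) hn.le
    rw [mul_add, mul_add, mul_div_cancel₀ _ hn.ne', mul_div_cancel₀ _ hn.ne'] at this
    exact this
  rw [div_le_iff₀ (by linarith)] at ha
  have hnP : 0 ≤ n * P := by positivity
  rcases le_or_gt s (2 * a) with h | h
  · nlinarith
  · have h3 : (s - 2 * a) * ((n + 2) * (2 * a + s) - 4) < 0 := by nlinarith
    have h4 : 0 < (n + 2) * (2 * a + s) - 4 := by nlinarith
    nlinarith [mul_pos (sub_pos.2 h) h4]

theorem sum_sq_sub_mul_normSq {ι : Type*} [Fintype ι] [DecidableEq ι] (E : ι → ℝ)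
    {σ : Matrix ι ι ℂ} (hσ : σ.IsHermitian) :
    -(((diagonal fun i => (E i : ℂ)) * σ - σ * diagonal fun i => (E i : ℂ)) *
      ((diagonal fun i => (E i : ℂ)) * σ - σ * diagonal fun i => (E i : ℂ))).trace
      = ((∑ i, ∑ j, (E i - E j) ^ 2 * normSq (σ i j) : ℝ) : ℂ) := by
  rw [Matrix.trace, ← Finset.sum_neg_distrib, ofReal_sum]
  refine Finset.sum_congr rfl fun i _ => ?_
  rw [Matrix.diag, Matrix.mul_apply, ← Finset.sum_neg_distrib, ofReal_sum]
  refine Finset.sum_congr rfl fun j _ => ?_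
  rw [Matrix.sub_apply, Matrix.sub_apply, diagonal_mul, mul_diagonal, diagonal_mul, mul_diagonal,
    ← hσ.apply j i, ofReal_mul, normSq_eq_conj_mul_self, starRingEnd_apply]
  push_cast
  ring

theorem exists_unit_vector_supported {ι : Type*} [Fintype ι] [DecidableEq ι] (c : ι → ℂ)
    (A : ι → Prop) [DecidablePred A] {a : ι} (ha : A a) :
    ∃ u : ι → ℂ, star u ⬝ᵥ u = 1 ∧ (∀ i, ¬ A i → u i = 0) ∧
      normSq (star u ⬝ᵥ c) = ∑ i, if A i then normSq (c i) else 0 := by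
  set S : ℝ := ∑ i, if A i then normSq (c i) else 0 with hS
  have hnn : ∀ i ∈ Finset.univ, 0 ≤ if A i then normSq (c i) else 0 := fun i _ => by
    split_ifs
    exacts [normSq_nonneg _, le_rfl]
  rcases (Finset.sum_nonneg hnn).eq_or_lt with h0 | hpos
  · have hca : normSq (c a) = 0 := by
      simpa [ha] using (Finset.sum_eq_zero_iff_of_nonneg hnn).1 h0.symm a (Finset.mem_univ a)
    refine ⟨Pi.single a 1, by simp, fun i hi => ?_, ?_⟩
    · exact Pi.single_eq_of_ne (by rintro rfl; exact hi ha) _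
    · rw [← hS] at h0
      rw [← h0]
      simpa using hca
  · rw [← hS] at hpos
    set m : ι → ℂ := fun i => if A i then c i else 0 with hm
    have hmm : star m ⬝ᵥ m = (S : ℂ) := by
      rw [hS, ofReal_sum]
      refine Finset.sum_congr rfl fun i _ => ?_
      by_cases h : A i <;> simp [hm, h, normSq_eq_conj_mul_self]
    have hmc : star m ⬝ᵥ c = (S : ℂ) := by
      rw [hS, ofReal_sum]
      refine Finset.sum_congr rfl fun i _ => ?_
      by_cases h : A i <;> simp [hm, h, normSq_eq_conj_mul_self]
    have hsq : ((√S : ℝ) : ℂ) * ((√S : ℝ) : ℂ) = (S : ℂ) := by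
      rw [← ofReal_mul, Real.mul_self_sqrt hpos.le]
    have hne : ((√S : ℝ) : ℂ) ≠ 0 := by
      rw [ofReal_ne_zero]; exact (Real.sqrt_pos.2 hpos).ne'
    have hst : star (((√S : ℝ) : ℂ)⁻¹ • m) = ((√S : ℝ) : ℂ)⁻¹ • star m := by
      rw [star_smul, star_inv₀, Complex.star_def, conj_ofReal]
    refine ⟨((√S : ℝ) : ℂ)⁻¹ • m, ?_, fun i hi => by simp [hm, hi], ?_⟩
    · rw [hst, smul_dotProduct, dotProduct_smul, hmm, smul_eq_mul, smul_eq_mul, ← hsq]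
      field_simp
    · rw [hst, smul_dotProduct, hmc, smul_eq_mul, ← hsq, inv_mul_cancel_left₀ hne, normSq_ofReal,
        Real.mul_self_sqrt hpos.le]

theorem exists_purity_bounds_of_two_level {ι : Type*} [Fintype ι] [DecidableEq ι]
    (hcard : 2 < Fintype.card ι)
    {σ : Matrix ι ι ℂ} (hσ : σ.PosSemidef) (htr : σ.trace = 1) {δ : ℝ} (hδ0 : 0 < δ)
    (hδ : δ ^ 2 ≤ 1 / 2) (hδ' : (1 - δ) ^ 2 ≤ 1 / 2) {F : ι → ℝ} {k a : ι} (hFk : F k = 1)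
    (hFa : F a = 0) (hF : ∀ i, i ≠ k → F i = 0 ∨ F i = δ) :
    ∃ s P : ℝ, 0 ≤ P ∧
      ∑ i, ∑ j, (F i - F j) ^ 2 * normSq (σ i j) ≤
        (∑ i, ∑ j, normSq (σ i j) - P - (1 - s) ^ 2 / ((Fintype.card ι : ℝ) - 2)) / 2 ∧
      s ^ 2 - P + (1 - s) ^ 2 / ((Fintype.card ι : ℝ) - 2) ≤ ∑ i, ∑ j, normSq (σ i j) := by
  have hδ1 : δ ≠ 1 := by rintro rfl; norm_num at hδ
  have hk0 : F k ≠ 0 := by rw [hFk]; exact one_ne_zero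
  have hFne : ∀ i, i ≠ k → F i ≠ 1 := fun i hi => by
    rcases hF i hi with h | h <;> rw [h]
    exacts [zero_ne_one, hδ1]
  obtain ⟨u, huu, hu0, huc⟩ := exists_unit_vector_supported (σ.col k) (fun i => F i = 0) hFa
  set M : ι → ℝ := fun i => if F i = 0 then normSq (σ i k) else 0 with hM
  set S : ℝ := ∑ i, M i with hS
  set N : Matrix ι ι ℂ := Matrix.of fun i j => if F i = F j then σ i j else 0 with hN
  set v : ι → ℂ := Pi.single k 1 with hv
  have hvv : star v ⬝ᵥ v = 1 := by simp [hv]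
  have huv : star u ⬝ᵥ v = 0 := by simp [hv, hu0 k hk0]
  have hquad := sum_normSq_ge_of_orthonormal_pair N u v huu hvv huv hcard
  have huNu : star u ⬝ᵥ N *ᵥ u = star u ⬝ᵥ σ *ᵥ u := by
    refine Finset.sum_congr rfl fun i _ => ?_
    by_cases hi : F i = 0
    · congr 1
      refine Finset.sum_congr rfl fun j _ => ?_
      by_cases hj : F j = 0
      · simp [hN, hi, hj]
      · simp [hu0 j hj]
    · simp [hu0 i hi]
  have hvNv : star v ⬝ᵥ N *ᵥ v = star v ⬝ᵥ σ *ᵥ v := by simp [hv, hN]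
  have hNtr : N.trace = 1 := by rw [← htr]; simp [Matrix.trace, hN]
  rw [huNu, hvNv, hNtr, one_re] at hquad
  have hcs := hσ.normSq_dotProduct_mulVec_le u v
  have hσv : σ *ᵥ v = σ.col k := by rw [hv, Matrix.mulVec_single_one]
  rw [hσv, huc, ← hσv] at hcs
  rw [show (∑ i, if F i = 0 then normSq ((σ *ᵥ v) i) else 0) = S by rw [hσv]; rfl] at hcs
  have hsymm : ∀ i j, normSq (σ i j) = normSq (σ j i) := fun i j => by
    rw [← hσ.1.apply i j, Complex.star_def, normSq_conj]
  have hnorm : ∀ i j, normSq (N i j) = if F i = F j then normSq (σ i j) else 0 := fun i j => by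
    by_cases h : F i = F j <;> simp [hN, h]
  have hsum1 : ∑ i, ∑ j, (if j = k then M i else 0) = S := by simp [hS]
  have hsum2 : ∑ i, ∑ j, (if i = k then M j else 0) = S := by
    rw [Finset.sum_comm]; simp [hS]
  have hMk : M k = 0 := by simp [hM, hk0]
  have hlow : ∑ i, ∑ j, normSq (N i j) + 2 * S ≤ ∑ i, ∑ j, normSq (σ i j) := by
    have : ∑ i, ∑ j, (normSq (N i j) + (if j = k then M i else 0) + (if i = k then M j else 0))
        ≤ ∑ i, ∑ j, normSq (σ i j) := by
      refine Finset.sum_le_sum fun i _ => Finset.sum_le_sum fun j _ => ?_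
      rw [hnorm]
      have hnn := normSq_nonneg (σ i j)
      by_cases hi : i = k <;> by_cases hj : j = k
      · subst hi hj; simp [hMk]
      · subst hi
        rw [if_neg (by rw [hFk]; exact (hFne j hj).symm), if_neg hj, if_pos rfl, hsymm]
        simp only [hM]
        rw [hsymm] at hnn
        split_ifs <;> linarith
      · subst hj
        rw [if_neg (by rw [hFk]; exact hFne i hi), if_pos rfl, if_neg hi]
        simp only [hM]
        split_ifs <;> linarith
      · rw [if_neg hi, if_neg hj]
        split_ifs <;> linarith
    simp only [Finset.sum_add_distrib] at this
    rw [hsum1, hsum2] at this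
    linarith
  have hup : 2 * ∑ i, ∑ j, (F i - F j) ^ 2 * normSq (σ i j) + ∑ i, ∑ j, normSq (N i j)
      ≤ ∑ i, ∑ j, normSq (σ i j) + 2 * S := by
    have : ∑ i, ∑ j, (2 * ((F i - F j) ^ 2 * normSq (σ i j)) + normSq (N i j))
        ≤ ∑ i, ∑ j, (normSq (σ i j) + (if j = k then M i else 0) + (if i = k then M j else 0)) := by
      refine Finset.sum_le_sum fun i _ => Finset.sum_le_sum fun j _ => ?_
      rw [hnorm]
      have hnn := normSq_nonneg (σ i j)
      have h1 := mul_le_mul_of_nonneg_right hδ hnn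
      have h2 := mul_le_mul_of_nonneg_right hδ' hnn
      by_cases hi : i = k <;> by_cases hj : j = k
      · subst hi hj; simp [hMk]
      · subst hi
        rw [if_neg (by rw [hFk]; exact (hFne j hj).symm), if_neg hj, if_pos rfl]
        simp only [hM]
        rw [hsymm j, hFk]
        rcases hF j hj with h | h
        · rw [h, if_pos rfl]; linarith
        · rw [h, if_neg hδ0.ne']; linarith
      · subst hj
        rw [if_neg (by rw [hFk]; exact hFne i hi), if_pos rfl, if_neg hi]
        simp only [hM]
        rw [hFk]
        rcases hF i hi with h | h
        · rw [h, if_pos rfl]; linarith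
        · rw [h, if_neg hδ0.ne']; linarith
      · rw [if_neg hi, if_neg hj]
        rcases hF i hi with h | h <;> rcases hF j hj with h' | h' <;> rw [h, h']
        · simp
        · rw [if_neg hδ0.ne]; linarith
        · rw [if_neg hδ0.ne']; linarith
        · simp
    simp only [Finset.sum_add_distrib, ← Finset.mul_sum] at this
    rw [hsum1, hsum2] at this
    linarith
  set q := (star u ⬝ᵥ σ *ᵥ u).re
  set p := (star v ⬝ᵥ σ *ᵥ v).re
  have hqp : 1 - q - p = 1 - (q + p) := by ring
  rw [hqp] at hquad
  refine ⟨q + p, 2 * (q * p - S), by linarith, by linarith [sq_nonneg (q - p)], by linarith⟩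

theorem speed_le_of_singleton_above {ι : Type*} [Fintype ι] [DecidableEq ι]
    (hcard : 2 < Fintype.card ι)
    {σ : Matrix ι ι ℂ} (hσ : σ.PosSemidef) (htr : σ.trace = 1) {δ : ℝ} (hδ0 : 0 < δ)
    (hδ : δ ^ 2 ≤ 1 / 2) (hδ' : (1 - δ) ^ 2 ≤ 1 / 2) {y : ι → ℝ} {k a : ι} (hyk : y k = 1)
    (hya : y a = 0) (hy : ∀ i, i ≠ k → y i ∈ Set.Icc 0 δ) {r : ℝ}
    (hr : 2 / (Fintype.card ι : ℝ) ≤ 2 * r) (hr1 : 2 * r ≤ 1)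
    (hκ : ∑ i, ∑ j, normSq (σ i j) = 4 * r ^ 2 + (1 - 2 * r) ^ 2 / ((Fintype.card ι : ℝ) - 2)) :
    ∑ i, ∑ j, (y i - y j) ^ 2 * normSq (σ i j) ≤ 2 * r ^ 2 := by
  have hak : a ≠ k := by rintro rfl; rw [hyk] at hya; exact one_ne_zero hya
  have hbounds : ∀ i, y i ∈ Set.Icc (if i = k then 1 else 0)
      (if i = k then 1 else if i = a then 0 else δ) := by
    intro i
    split_ifs with h1 h2
    · rw [h1, hyk]; simp
    · rw [h2, hya]; simp
    · exact hy i h1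
  obtain ⟨F, hF, hle⟩ := (convexOn_sum_sq_sub_mul (fun i j => normSq (σ i j))
    fun i j => normSq_nonneg _).exists_ge_endpoints_of_mem_Icc hbounds
  have hFk : F k = 1 := by simpa using hF k
  have hFa : F a = 0 := by simpa [hak] using hF a
  obtain ⟨s, P, hP, h1, h2⟩ := exists_purity_bounds_of_two_level hcard hσ htr hδ0 hδ hδ' hFk hFa fun i hi => by
    rcases hF i with h | h
    · left; simpa [hi] using h
    · by_cases hia : i = a
      · left; rw [hia, hFa]
      · right; simpa [hi, hia] using h
  have hc : (0 : ℝ) < (Fintype.card ι : ℝ) - 2 := by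
    have : (2 : ℝ) < Fintype.card ι := by exact_mod_cast hcard
    linarith
  exact hle.trans (speed_le_of_purity_bounds hc (by rwa [sub_add_cancel]) hr1 hκ.symm hP h1 h2)

theorem speed_le_of_inner_gap {ι : Type*} [Fintype ι] [DecidableEq ι]
    (hcard : 2 < Fintype.card ι)
    {σ : Matrix ι ι ℂ} (hσ : σ.PosSemidef) (htr : σ.trace = 1) {t : ι → ℝ} {a k : ι} {l h : ℝ}
    (hta : t a = 0) (htk : t k = 1) (hl : 0 ≤ l) (hh : h ≤ 1) (hlh : 2 * (h - l) ^ 2 ≤ 1)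
    (ht : ∀ i, i ≠ a → i ≠ k → t i ∈ Set.Icc l h) {r : ℝ}
    (hr : 2 / (Fintype.card ι : ℝ) ≤ 2 * r) (hr1 : 2 * r ≤ 1)
    (hκ : ∑ i, ∑ j, normSq (σ i j) = 4 * r ^ 2 + (1 - 2 * r) ^ 2 / ((Fintype.card ι : ℝ) - 2)) :
    ∑ i, ∑ j, (t i - t j) ^ 2 * normSq (σ i j) ≤ 2 * r ^ 2 := by
  have hak : a ≠ k := by rintro rfl; rw [htk] at hta; exact one_ne_zero hta
  set δ : ℝ := √(1 / 2) with hδdef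
  have hδsq : δ ^ 2 = 1 / 2 := Real.sq_sqrt (by norm_num)
  have hδ0 : 0 < δ := Real.sqrt_pos.2 (by norm_num)
  have hδ1 : δ < 1 := by nlinarith
  have hδ' : (1 - δ) ^ 2 ≤ 1 / 2 := by nlinarith
  have hlhδ : h - l ≤ δ := (abs_le_of_sq_le_sq' (by linarith) hδ0.le).2
  set e : ℝ := min l (1 - δ) with he
  have he0 : 0 ≤ e := le_min hl (by linarith)
  have he1 : e ≤ 1 - δ := min_le_right _ _
  have hel : e ≤ l := min_le_left _ _
  have hhe : h - e ≤ δ := by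
    rcases min_choice l (1 - δ) with h' | h' <;> rw [he, h'] <;> linarith
  set y : ι → ℝ := fun i => if i = a then 0 else if i = k then 1 else t i - e with hy
  set z : ι → ℝ := fun i => if i = a then 1 else if i = k then 0 else δ - (t i - e) with hz
  have hinner : ∀ i, i ≠ a → i ≠ k → 0 ≤ t i - e ∧ t i - e ≤ δ := fun i hia hik => by
    have := ht i hia hik
    exact ⟨by linarith [this.1], by linarith [this.2]⟩
  have hby : ∑ i, ∑ j, (y i - y j) ^ 2 * normSq (σ i j) ≤ 2 * r ^ 2 := by
    refine speed_le_of_singleton_above hcard hσ htr hδ0 hδsq.le hδ' (k := k) (a := a) (by simp [hy, hak.symm])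
      (by simp [hy]) (fun i hi => ?_) hr hr1 hκ
    by_cases hia : i = a
    · simp [hy, hia, hδ0.le]
    · have := hinner i hia hi
      simp only [hy, if_neg hia, if_neg hi]
      exact this
  have hbz : ∑ i, ∑ j, (z i - z j) ^ 2 * normSq (σ i j) ≤ 2 * r ^ 2 := by
    refine speed_le_of_singleton_above hcard hσ htr hδ0 hδsq.le hδ' (k := a) (a := k) (by simp [hz])
      (by simp [hz, hak.symm]) (fun i hi => ?_) hr hr1 hκ
    by_cases hik : i = k
    · simp [hz, hik, hak.symm, hδ0.le]
    · have := hinner i hi hik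
      simp only [hz, if_neg hi, if_neg hik]
      exact ⟨by linarith [this.2], by linarith [this.1]⟩
  have hbz' : ∑ i, ∑ j, ((1 - z) i - (1 - z) j) ^ 2 * normSq (σ i j) ≤ 2 * r ^ 2 := by
    refine le_of_eq_of_le (Finset.sum_congr rfl fun i _ => Finset.sum_congr rfl fun j _ => ?_) hbz
    rw [Pi.sub_apply, Pi.sub_apply, Pi.one_apply, Pi.one_apply]
    ring
  have hδne : 1 - δ ≠ 0 := by linarith
  have hcomb : t = (1 - e / (1 - δ)) • y + (e / (1 - δ)) • (1 - z) := by
    funext i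
    simp only [Pi.add_apply, Pi.smul_apply, smul_eq_mul, Pi.sub_apply, Pi.one_apply]
    by_cases hia : i = a
    · simp [hy, hz, hia, hta]
    · by_cases hik : i = k
      · simp [hy, hz, hik, htk, hak.symm]
      · simp only [hy, hz, if_neg hia, if_neg hik]
        field_simp
        ring
  have hw1 : 0 ≤ 1 - e / (1 - δ) := by rw [sub_nonneg, div_le_one (by linarith)]; exact he1
  have hw2 : 0 ≤ e / (1 - δ) := div_nonneg he0 (by linarith)
  have hconv := (convexOn_sum_sq_sub_mul (fun i j => normSq (σ i j)) fun i j => normSq_nonneg _).2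
    (Set.mem_univ y) (Set.mem_univ (1 - z)) hw1 hw2 (sub_add_cancel _ _)
  rw [← hcomb] at hconv
  refine hconv.trans ?_
  have := add_le_add (mul_le_mul_of_nonneg_left hby hw1) (mul_le_mul_of_nonneg_left hbz' hw2)
  simp only [smul_eq_mul]
  linarith

theorem optimal_weight_properties {n κ x : ℝ} (hn : 0 < n)
    (hκ : κ ∈ Set.Icc (1 / (n + 2) + 2 / (n + 2) ^ 2) 1)
    (hx : x = n / (2 * (n + 2) * (n + 1)) * (-1 + (n + 2) * √((-1 + (n + 1) * κ) / n))) :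
    2 / (n + 2) ≤ 2 * (1 / (n + 2) + x) ∧ 2 * (1 / (n + 2) + x) ≤ 1 ∧
      κ = 4 * (1 / (n + 2) + x) ^ 2 + (1 - 2 * (1 / (n + 2) + x)) ^ 2 / n := by
  set w := (-1 + (n + 1) * κ) / n with hw
  have hlow : (1 / (n + 2)) ^ 2 ≤ w := by
    rw [hw, le_div_iff₀ hn]
    have := mul_le_mul_of_nonneg_left hκ.1 (by linarith : 0 ≤ n + 1)
    have h2 : (n + 1) * (1 / (n + 2) + 2 / (n + 2) ^ 2) = 1 + (1 / (n + 2)) ^ 2 * n := by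
      field_simp; ring
    linarith
  have hup : w ≤ 1 := by
    rw [hw, div_le_one hn]
    have := mul_le_mul_of_nonneg_left hκ.2 (by linarith : 0 ≤ n + 1)
    linarith
  have hs1 : 1 / (n + 2) ≤ √w := Real.le_sqrt_of_sq_le hlow
  have hs2 : √w ≤ 1 := Real.sqrt_le_one.2 hup
  have hsq : √w ^ 2 = w := Real.sq_sqrt ((by positivity : (0 : ℝ) ≤ _).trans hlow)
  have hκw : κ = (1 + n * √w ^ 2) / (n + 1) := by rw [hsq, hw]; field_simp; ring
  rw [div_le_iff₀ (by linarith)] at hs1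
  have hx0 : 0 ≤ x := by
    rw [hx]; exact mul_nonneg (by positivity) (by linarith)
  have hx1 : x ≤ 1 / 2 - 1 / (n + 2) := by
    have : 1 / 2 - 1 / (n + 2) = n / (2 * (n + 2) * (n + 1)) * (n + 1) := by field_simp; ring
    rw [hx, this]
    exact mul_le_mul_of_nonneg_left (by nlinarith) (by positivity)
  refine ⟨?_, by linarith, ?_⟩
  · have : 2 / (n + 2) = 2 * (1 / (n + 2)) := by ring
    linarith
  · rw [hκw, hx]
    field_simp
    ring

/-- The matrix `α |ψ⟩⟨ψ| + β P`, with `P` the projection onto the basis vectors away from `a`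
and `k`, where `|ψ⟩` is supported on `{a, k}` with weights `1/2`. -/
theorem two_level_superposition_properties {ι : Type*} [Fintype ι] [DecidableEq ι]
    {a k : ι} (hak : a ≠ k) {α β : ℝ}
    (hα : 0 ≤ α) (hβ : 0 ≤ β) {ψ : ι → ℂ}
    (hψ : ∀ i, normSq (ψ i) = (if i = a then 1 / 2 else 0) + if i = k then 1 / 2 else 0)
    {ρ : Matrix ι ι ℂ} (hρ : ρ = (α : ℂ) • vecMulVec ψ (star ψ)
      + (β : ℂ) • diagonal fun i => if i = a ∨ i = k then 0 else 1) :
    ρ.PosSemidef ∧ ρ.trace = ((α + β * ((Fintype.card ι : ℝ) - 2) : ℝ) : ℂ) ∧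
      (ρ * ρ).trace = ((α ^ 2 + β ^ 2 * ((Fintype.card ι : ℝ) - 2) : ℝ) : ℂ) ∧
      ∀ E : ι → ℝ, ∑ i, ∑ j, (E i - E j) ^ 2 * normSq (ρ i j) = α ^ 2 * (E k - E a) ^ 2 / 2 := by
  set D : Matrix ι ι ℂ := diagonal fun i => if i = a ∨ i = k then 0 else 1 with hD
  have hψψ : ψ ⬝ᵥ star ψ = 1 := by
    have : ψ ⬝ᵥ star ψ = ((∑ i, normSq (ψ i) : ℝ) : ℂ) := by
      rw [ofReal_sum]
      exact Finset.sum_congr rfl fun i _ => (mul_conj _)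
    rw [this]
    simp only [hψ, Finset.sum_add_distrib, Finset.sum_ite_eq', Finset.mem_univ, if_true]
    norm_num
  have hDtr : D.trace = ((Fintype.card ι : ℝ) - 2 : ℝ) := by
    have h1 : ∀ i : ι, (if i = a ∨ i = k then (0 : ℂ) else 1)
        = 1 - (if i = a then 1 else 0) - if i = k then 1 else 0 := fun i => by
      by_cases hia : i = a
      · simp [hia, hak]
      · simp [hia]; split_ifs <;> simp
    rw [hD, Matrix.trace_diagonal]
    simp only [h1, Finset.sum_sub_distrib, Finset.sum_ite_eq', Finset.mem_univ, if_true]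
    simp
    ring
  have hDD : D * D = D := by
    rw [hD, diagonal_mul_diagonal]
    congr 1
    funext i
    split_ifs <;> simp
  have hDψ : D *ᵥ ψ = 0 := by
    funext i
    rw [hD, mulVec_diagonal, Pi.zero_apply]
    split_ifs with h
    · simp
    · push Not at h
      rw [one_mul, ← normSq_eq_zero, hψ, if_neg h.1, if_neg h.2, add_zero]
  have hDV : D * vecMulVec ψ (star ψ) = 0 := by
    rw [Matrix.mul_vecMulVec, hDψ, Matrix.zero_vecMulVec]
  have hVV : vecMulVec ψ (star ψ) * vecMulVec ψ (star ψ) = vecMulVec ψ (star ψ) := by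
    rw [vecMulVec_mul_vecMulVec, dotProduct_comm, hψψ, one_smul]
  have hVD : (vecMulVec ψ (star ψ) * D).trace = 0 := by
    rw [Matrix.trace_mul_comm, hDV, Matrix.trace_zero]
  refine ⟨?_, ?_, ?_, fun E => ?_⟩
  · rw [hρ]
    refine ((posSemidef_vecMulVec_self_star ψ).smul (zero_le_real.2 hα)).add
      (PosSemidef.smul (posSemidef_diagonal_iff.2 fun i => ?_) (zero_le_real.2 hβ))
    split_ifs <;> simp
  · rw [hρ, trace_add, trace_smul, trace_smul, trace_vecMulVec, hψψ, hDtr]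
    simp
  · rw [hρ, Matrix.add_mul, Matrix.mul_add, Matrix.mul_add]
    simp only [Matrix.smul_mul, Matrix.mul_smul, trace_add, trace_smul, hVV, hDV, hVD, hDD,
      trace_vecMulVec, hψψ, hDtr]
    simp
    ring
  · have h1 : ∀ i j, (E i - E j) ^ 2 * normSq (ρ i j)
        = α ^ 2 * ((E i - E j) ^ 2 * (normSq (ψ i) * normSq (ψ j))) := fun i j => by
      by_cases hij : i = j
      · simp [hij]
      · rw [hρ]
        simp [hD, hij, vecMulVec_apply]
        ring
    simp only [h1, hψ, mul_add, add_mul, Finset.sum_add_distrib, mul_ite, ite_mul,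
      zero_mul, mul_zero, Finset.sum_ite_eq', Finset.mem_univ, if_true]
    simp
    ring

/-- For `d ≥ 4`, strictly increasing energies with
`γ₁ = (E_d − E₁)²/(E_{d−1} − E₂)² ≥ 2`, and purity `κ ∈ [1/d + 2/d², 1]`, every
density matrix `σ` of purity `κ` has squared speed at most `2(1/d + x)²(E_d − E₁)²`
with `x = (d−2)/(2d(d−1))·(−1 + d√((−1+(d−1)κ)/(d−2)))`; the state
`ρ_κ = 2(1/d+x)|Ψ₁⟩⟨Ψ₁| + (1/d − 2x/(d−2))Σ_{i=2}^{d−1}|e_i⟩⟨e_i|` is an optimal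
density matrix of purity `κ`. -/
theorem optimal_speed_bound_gamma_ge_two {d : ℕ} (hd : 4 ≤ d)
    (E : Fin d → ℝ) (hE : StrictMono E)
    (hγ : 2 ≤ (E (⟨d - 1, by omega⟩ : Fin d) - E (⟨0, by omega⟩ : Fin d))^2
        / (E (⟨d - 2, by omega⟩ : Fin d) - E (⟨1, by omega⟩ : Fin d))^2)
    (H : Matrix (Fin d) (Fin d) ℂ)
    (hH : H = Matrix.diagonal fun i => (E i : ℂ))
    (κ : ℝ) (hκ : κ ∈ Set.Icc (1 / (d : ℝ) + 2 / (d : ℝ)^2) 1)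
    (θ : ℝ) (x : ℝ)
    (hx : x = ((d : ℝ) - 2) / (2 * d * ((d : ℝ) - 1))
        * (-1 + (d : ℝ) * Real.sqrt ((-1 + ((d : ℝ) - 1) * κ) / ((d : ℝ) - 2))))
    (Ψ : Fin d → ℂ)
    (hΨ : Ψ = ((Real.sqrt 2 : ℂ))⁻¹ •
        ((Pi.single (⟨0, by omega⟩ : Fin d) 1 : Fin d → ℂ)
          + Complex.exp (-(θ : ℂ) * Complex.I) • (Pi.single (⟨d - 1, by omega⟩ : Fin d) 1 : Fin d → ℂ)))
    (ρκ : Matrix (Fin d) (Fin d) ℂ)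
    (hρκ : ρκ = ((2 * (1 / (d : ℝ) + x) : ℝ) : ℂ) • Matrix.vecMulVec Ψ (star Ψ)
        + ((1 / (d : ℝ) - 2 * x / ((d : ℝ) - 2) : ℝ) : ℂ) •
            Matrix.diagonal (fun i : Fin d =>
              if i = (⟨0, by omega⟩ : Fin d) ∨ i = (⟨d - 1, by omega⟩ : Fin d) then 0 else 1)) :
    (∀ σ : Matrix (Fin d) (Fin d) ℂ,
        σ.PosSemidef → σ.trace = 1 → (σ * σ).trace = (κ : ℂ) →
        (-(((H * σ - σ * H) * (H * σ - σ * H)).trace)).re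
          ≤ 2 * (1 / (d : ℝ) + x)^2
              * (E (⟨d - 1, by omega⟩ : Fin d) - E (⟨0, by omega⟩ : Fin d))^2)
    ∧ ρκ.PosSemidef ∧ ρκ.trace = 1 ∧ (ρκ * ρκ).trace = (κ : ℂ)
    ∧ -(((H * ρκ - ρκ * H) * (H * ρκ - ρκ * H)).trace)
        = ((2 * (1 / (d : ℝ) + x)^2
            * (E (⟨d - 1, by omega⟩ : Fin d) - E (⟨0, by omega⟩ : Fin d))^2 : ℝ) : ℂ) := by
  have hd' : (4 : ℝ) ≤ d := by exact_mod_cast hd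
  set a : Fin d := ⟨0, by omega⟩ with ha
  set k : Fin d := ⟨d - 1, by omega⟩ with hk
  set a' : Fin d := ⟨1, by omega⟩ with ha'
  set k' : Fin d := ⟨d - 2, by omega⟩ with hk'
  have hak : a ≠ k := by simp only [ha, hk, ne_eq, Fin.mk.injEq]; omega
  have hW : 0 < E k - E a := sub_pos.2 (hE (by simp only [ha, hk, Fin.mk_lt_mk]; omega))
  have hW' : 0 < E k' - E a' := sub_pos.2 (hE (by simp only [ha', hk', Fin.mk_lt_mk]; omega))
  obtain ⟨h1, h2, h3⟩ := optimal_weight_properties (n := (d : ℝ) - 2) (κ := κ) (x := x) (by linarith)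
    (by rwa [sub_add_cancel])
    (by rw [sub_add_cancel, show (d : ℝ) - 2 + 1 = d - 1 by ring]; exact hx)
  rw [sub_add_cancel] at h1 h2 h3
  set r : ℝ := 1 / d + x with hr
  have hr0 : 0 ≤ 2 * r := le_trans (by positivity) h1
  have hn0 : (d : ℝ) - 2 ≠ 0 := by linarith
  have hd0 : (d : ℝ) ≠ 0 := by linarith
  have hβ : 1 / (d : ℝ) - 2 * x / ((d : ℝ) - 2) = (1 - 2 * r) / (d - 2) := by
    rw [hr]; field_simp; ring
  refine ⟨fun σ hσ htr hpur => ?_, ?_⟩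
  · rw [hH, sum_sq_sub_mul_normSq E hσ.1, ofReal_re]
    have hpur' : ∑ i, ∑ j, normSq (σ i j) = κ := by
      have := trace_conjTranspose_mul_self_eq_sum_normSq σ
      rw [hσ.1.eq, hpur] at this
      exact (ofReal_inj.1 this).symm
    rw [le_div_iff₀ (by positivity)] at hγ
    have key := speed_le_of_inner_gap (by rw [Fintype.card_fin]; omega) hσ htr
      (t := fun i => (E i - E a) / (E k - E a)) (a := a) (k := k)
      (l := (E a' - E a) / (E k - E a)) (h := (E k' - E a) / (E k - E a))
      (by simp) (div_self hW.ne')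
      (div_nonneg (sub_nonneg.2 (hE.monotone (by simp only [ha, ha', Fin.mk_le_mk]; omega))) hW.le)
      (by
        rw [div_le_one hW]
        have := hE.monotone (show k' ≤ k by simp only [hk, hk', Fin.mk_le_mk]; omega)
        linarith)
      (by
        rw [← sub_div, sub_sub_sub_cancel_right, div_pow, ← mul_div_assoc,
          div_le_one (by positivity)]
        exact hγ)
      (fun i hia hik => by
        simp only [ha, hk, ne_eq, Fin.ext_iff] at hia hik
        have hi := i.isLt
        have e1 := hE.monotone (show a' ≤ i by simp only [ha', Fin.le_def]; omega)
        have e2 := hE.monotone (show i ≤ k' by simp only [hk', Fin.le_def]; omega)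
        exact ⟨by gcongr, by gcongr⟩)
      (r := r) (by rwa [Fintype.card_fin]) h2 (by rw [Fintype.card_fin, hpur']; exact h3)
    have hscale : ∑ i, ∑ j, (E i - E j) ^ 2 * normSq (σ i j)
        = (∑ i, ∑ j, ((E i - E a) / (E k - E a) - (E j - E a) / (E k - E a)) ^ 2
          * normSq (σ i j)) * (E k - E a) ^ 2 := by
      simp only [Finset.sum_mul]
      refine Finset.sum_congr rfl fun i _ => Finset.sum_congr rfl fun j _ => ?_
      field_simp
      ring
    rw [hscale]
    exact mul_le_mul_of_nonneg_right key (sq_nonneg _)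
  · rw [hβ] at hρκ
    have hΨ' : ∀ i, normSq (Ψ i) = (if i = a then 1 / 2 else 0) + if i = k then 1 / 2 else 0 := by
      have hexp : normSq (Complex.exp (-(θ : ℂ) * Complex.I)) = 1 := by
        rw [normSq_eq_norm_sq, ← ofReal_neg, norm_exp_ofReal_mul_I, one_pow]
      intro i
      rw [hΨ]
      by_cases hia : i = a
      · simp [hia, hak]
      · by_cases hik : i = k
        · simp only [hik, Pi.smul_apply, Pi.add_apply, Pi.single_eq_same, smul_eq_mul,
            Pi.single_eq_of_ne hak.symm, zero_add, mul_one, normSq_mul, hexp, if_neg hak.symm,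
            if_true]
          simp
        · simp [hia, hik]
    obtain ⟨c1, c2, c3, c4⟩ := two_level_superposition_properties hak hr0
      (div_nonneg (by linarith) (by linarith) : 0 ≤ (1 - 2 * r) / ((d : ℝ) - 2)) hΨ' hρκ
    rw [Fintype.card_fin] at c2 c3
    refine ⟨c1, ?_, ?_, ?_⟩
    · rw [c2, div_mul_cancel₀ _ hn0]
      norm_num
    · rw [c3, h3]
      congr 1
      field_simp
      ring
    · rw [hH, sum_sq_sub_mul_normSq E c1.1, c4]
      congr 1
      ring
end

section
/- Let d ≥ 4, let H = diag(E₁,…,E_d) with E₁ < E₂ < ⋯ < E_d, and suppose γ₁ := (E_d − E₁)²/(E_{d−1} − E₂)² < 2. Define κ₁ := (4 + (d−2)(2−γ₁)²)/(2(d−1) − (d−2)γ₁)². Then for every κ ∈ [1/d + 2/d², κ₁], every density matrix σ ∈ M_d(ℂ) with Tr(σ²) = κ satisfies −Tr([H,σ]²) ≤ 2(1/d + x)²(E_d − E₁)², where x := (d−2)/(2d(d−1)) · (−1 + d·√((−1 + (d−1)κ)/(d−2))); this bound is attained by ρ_κ := 2(1/d+x)|Ψ₁⟩⟨Ψ₁|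 + (1/d − 2x/(d−2))Σ_{i=2}^{d−1}|e_i⟩⟨e_i| with Ψ₁ = (e₁ + e^{−iθ}e_d)/√2. -/
open Matrix Complex
open scoped ComplexOrder

section
variable {n : Type*} [Fintype n]

theorem trace_mul_self_eq_sum_normSq {σ : Matrix n n ℂ} (hσ : σ.IsHermitian) :
    (σ * σ).trace = ((∑ i, ∑ j, ‖σ i j‖ ^ 2 : ℝ) : ℂ) := by
  simp only [Matrix.trace, Matrix.diag, Matrix.mul_apply]
  push_cast
  refine Finset.sum_congr rfl fun i _ => Finset.sum_congr rfl fun j _ => ?_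
  rw [← hσ.apply j i, ← Complex.mul_conj']
  rfl

theorem neg_trace_commutator_sq_eq_sum [DecidableEq n] (E : n → ℝ) {σ : Matrix n n ℂ}
    (hσ : σ.IsHermitian) :
    -(((diagonal (fun i => (E i : ℂ)) * σ - σ * diagonal (fun i => (E i : ℂ))) *
      (diagonal (fun i => (E i : ℂ)) * σ - σ * diagonal (fun i => (E i : ℂ)))).trace)
      = ((∑ i, ∑ j, (E i - E j) ^ 2 * ‖σ i j‖ ^ 2 : ℝ) : ℂ) := by
  simp only [Matrix.trace, Matrix.diag, Matrix.mul_apply (M := _ - _), Matrix.sub_apply,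
    Matrix.diagonal_mul, Matrix.mul_diagonal]
  push_cast
  rw [← Finset.sum_neg_distrib]
  refine Finset.sum_congr rfl fun i _ => ?_
  rw [← Finset.sum_neg_distrib]
  refine Finset.sum_congr rfl fun j _ => ?_
  rw [← hσ.apply j i, ← Complex.mul_conj']
  simp only [starRingEnd_apply]
  ring

/-- Pinching inequality: entries of `σ` on the support of `K` dominate the duality pairing. -/
theorem two_mul_trace_sub_le_sum_support {σ K : Matrix n n ℂ} (hK : K.IsHermitian)
    (B : n → n → Prop) [∀ i j, Decidable (B i j)] (hB : ∀ i j, ¬ B i j → K i j = 0) :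
    2 * (σ * K).trace.re - (K * K).trace.re ≤ ∑ i, ∑ j, if B i j then ‖σ i j‖ ^ 2 else 0 := by
  rw [trace_mul_self_eq_sum_normSq hK, Complex.ofReal_re]
  simp only [Matrix.trace, Matrix.diag, Matrix.mul_apply, Complex.re_sum]
  rw [Finset.mul_sum, ← Finset.sum_sub_distrib]
  refine Finset.sum_le_sum fun i _ => ?_
  rw [Finset.mul_sum, ← Finset.sum_sub_distrib]
  refine Finset.sum_le_sum fun j _ => ?_
  rw [← hK.apply j i]
  split_ifs with h
  · rw [← Complex.normSq_eq_norm_sq, ← Complex.normSq_eq_norm_sq, Complex.normSq_apply,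
      Complex.normSq_apply]
    simp only [Complex.star_def, Complex.mul_re, Complex.conj_re, Complex.conj_im]
    nlinarith [sq_nonneg ((σ i j).re - (K i j).re), sq_nonneg ((σ i j).im - (K i j).im)]
  · simp [hB i j h]

theorem exists_unit_vector_of_support (c : n → ℂ) {S : Finset n} (hS : S.Nonempty)
    (hc : ∀ i ∉ S, c i = 0) :
    ∃ (f : n → ℂ) (C : ℝ), 0 ≤ C ∧ star f ⬝ᵥ f = 1 ∧ (∀ i ∉ S, f i = 0) ∧ star f ⬝ᵥ c = C ∧
      ∑ i, ‖c i‖ ^ 2 = C ^ 2 := by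
  classical
  have hself (v : n → ℂ) : star v ⬝ᵥ v = ((∑ i, ‖v i‖ ^ 2 : ℝ) : ℂ) := by
    simp only [dotProduct, Pi.star_apply, Complex.star_def, Complex.conj_mul']
    push_cast; rfl
  have hnn : 0 ≤ ∑ i, ‖c i‖ ^ 2 := Finset.sum_nonneg fun i _ => by positivity
  rcases hnn.eq_or_lt with h0 | hpos
  · obtain ⟨s, hs⟩ := hS
    have hc0 : c = 0 := by
      ext i
      have := (Finset.sum_eq_zero_iff_of_nonneg (fun i _ => by positivity)).1 h0.symm i
        (Finset.mem_univ i)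
      simpa using this
    refine ⟨Pi.single s 1, 0, le_rfl, by simp, fun i hi => ?_, by simp [hc0], by simp [hc0]⟩
    exact Pi.single_eq_of_ne (fun h : i = s => hi (h ▸ hs)) _
  · set N := ∑ i, ‖c i‖ ^ 2 with hN
    have hC : Real.sqrt N ≠ 0 := (Real.sqrt_pos.2 hpos).ne'
    have hCc : ((Real.sqrt N : ℝ) : ℂ) ≠ 0 := by exact_mod_cast hC
    have hsq : ((Real.sqrt N : ℝ) : ℂ) ^ 2 = (N : ℂ) := by
      rw [← Complex.ofReal_pow, Real.sq_sqrt hnn]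
    refine ⟨((Real.sqrt N : ℝ) : ℂ)⁻¹ • c, Real.sqrt N, Real.sqrt_nonneg N, ?_,
      fun i hi => by simp [hc i hi], ?_, ?_⟩
    · rw [star_smul, smul_dotProduct, dotProduct_smul, hself, ← hN, ← hsq]
      simp only [star_inv₀, Complex.star_def, Complex.conj_ofReal, smul_eq_mul]
      field_simp
    · rw [star_smul, smul_dotProduct, hself, ← hN, ← hsq]
      simp only [star_inv₀, Complex.star_def, Complex.conj_ofReal, smul_eq_mul]
      field_simp
    · rw [Real.sq_sqrt hnn]

theorem exists_bound_of_three_levels [DecidableEq n] {σ : Matrix n n ℂ} (hσ : σ.PosSemidef)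
    (htr : σ.trace = 1) (hcard : 2 < Fintype.card n) (E : n → ℝ) (z : n) {S : Finset n}
    (hS : S.Nonempty) (hz : z ∉ S) {A B M W : ℝ} (hA : ∀ i ∈ S, E i = A)
    (hB : ∀ i ∉ S, i ≠ z → E i = B) (hMW : M ≤ W) (hM : 0 ≤ M) (hAz : (A - E z) ^ 2 ≤ W)
    (hAB : (A - B) ^ 2 ≤ M) (hBz : (B - E z) ^ 2 ≤ M) :
    ∃ t : ℝ, ∑ i, ∑ j, (E i - E j) ^ 2 * ‖σ i j‖ ^ 2 ≤ (W - M) * (t ^ 2 / 2) +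
      M * (∑ i, ∑ j, ‖σ i j‖ ^ 2 - t ^ 2 / 2 - (1 - t) ^ 2 / ((Fintype.card n : ℝ) - 2)) := by
  obtain ⟨f, C, hC0, hf1, hfS, hfc, hC⟩ := exists_unit_vector_of_support
    (fun i => if i ∈ S then σ i z else 0) hS (fun i hi => by simp [hi])
  have hfz : f z = 0 := hfS z hz
  have hfσ : star f ⬝ᵥ (σ *ᵥ Pi.single z 1) = C := by
    rw [← hfc]
    simp only [dotProduct, Matrix.mulVec_single_one, Matrix.col_apply, Pi.star_apply]
    refine Finset.sum_congr rfl fun i _ => ?_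
    by_cases hi : i ∈ S
    · simp [hi]
    · simp [hi, hfS i hi]
  set e : n → ℂ := Pi.single z 1 with he
  have hefσ : star e ⬝ᵥ (σ *ᵥ f) = C := by
    have := congrArg star hfσ
    rw [← hσ.1.eq] at this
    rw [star_dotProduct, star_star, star_mulVec, conjTranspose_conjTranspose,
      ← dotProduct_mulVec] at this
    simpa using this
  set r : ℝ := (star f ⬝ᵥ (σ *ᵥ f)).re with hr
  set q : ℝ := (star e ⬝ᵥ (σ *ᵥ e)).re with hq
  have hCt : C ≤ (r + q) / 2 := by
    have h := (RCLike.nonneg_iff.1 (hσ.dotProduct_mulVec_nonneg (f - e))).1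
    rw [star_sub, mulVec_sub, sub_dotProduct, dotProduct_sub, dotProduct_sub, hfσ, hefσ] at h
    simp at h
    linarith
  have hee : star e ⬝ᵥ e = 1 := by simp [he]
  have hef : star e ⬝ᵥ f = 0 := by simp [he, hfz]
  have hfe : star f ⬝ᵥ e = 0 := by simp [he, hfz]
  set t : ℝ := r + q with ht
  set N : ℝ := (Fintype.card n : ℝ) - 2 with hN
  have hNpos : 0 < N := by
    have : (2 : ℝ) < Fintype.card n := by exact_mod_cast hcard
    rw [hN]; linarith
  set β : ℝ := (1 - t) / N with hβ
  set δ : ℝ := t / 2 - β with hδ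
  set P : Matrix n n ℂ := vecMulVec f (star f) + vecMulVec e (star e) with hP
  set K : Matrix n n ℂ := (β : ℂ) • (1 : Matrix n n ℂ) + (δ : ℂ) • P with hK
  have hPherm : P.IsHermitian := by
    simp [hP, Matrix.IsHermitian, conjTranspose_add, conjTranspose_vecMulVec]
  have hKherm : K.IsHermitian := by
    rw [Matrix.IsHermitian, hK, conjTranspose_add, conjTranspose_smul, conjTranspose_smul,
      hPherm.eq]
    simp
  have hPP : P * P = P := by
    simp [hP, add_mul, mul_add, vecMulVec_mul_vecMulVec, hf1, hee, hef, hfe]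
  have hPtr : P.trace = 2 := by
    rw [hP, trace_add, trace_vecMulVec, trace_vecMulVec, dotProduct_comm, hf1,
      dotProduct_comm, hee]
    norm_num
  have hσP : (σ * P).trace.re = t := by
    rw [hP, mul_add, trace_add, mul_vecMulVec, mul_vecMulVec, trace_vecMulVec, trace_vecMulVec,
      dotProduct_comm, dotProduct_comm (σ *ᵥ e), Complex.add_re]
  have hσK : (σ * K).trace.re = β + δ * t := by
    rw [hK, mul_add, trace_add, Matrix.mul_smul, Matrix.mul_smul, trace_smul, trace_smul,
      mul_one, htr, Complex.add_re, smul_eq_mul, smul_eq_mul, Complex.re_ofReal_mul,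
      Complex.re_ofReal_mul, hσP]
    simp
  have hKK : (K * K).trace.re = β ^ 2 * (N + 2) + 4 * β * δ + 2 * δ ^ 2 := by
    have : (K * K).trace = ((β ^ 2 * (N + 2) + 4 * β * δ + 2 * δ ^ 2 : ℝ) : ℂ) := by
      simp only [hK, add_mul, mul_add, smul_mul_assoc, Matrix.mul_smul, one_mul, mul_one, hPP,
        trace_add, trace_smul, hPtr, trace_one, smul_eq_mul, hN]
      push_cast
      ring
    rw [this, Complex.ofReal_re]
  have hpinch := two_mul_trace_sub_le_sum_support (σ := σ) hKherm
    (fun i j => (i ∈ S ↔ j ∈ S) ∧ (i = z ↔ j = z)) (by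
      intro i j hij
      have hne : i ≠ j := by rintro rfl; simp at hij
      have h1 : f i * star (f j) = 0 := by
        by_cases hi : i ∈ S
        · by_cases hj : j ∈ S
          · exact absurd ⟨by simp [hi, hj], by
              constructor <;> rintro rfl <;> contradiction⟩ hij
          · simp [hfS j hj]
        · simp [hfS i hi]
      have h2 : e i * star (e j) = 0 := by
        by_cases hi : i = z
        · have hj : j ≠ z := fun h => hne (hi.trans h.symm)
          simp [he, hj]
        · simp [he, hi]
      simp only [hK, hP, Matrix.add_apply, Matrix.smul_apply, Matrix.one_apply_ne hne,
        vecMulVec_apply, Pi.star_apply, h1, h2]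
      simp)
  rw [hσK, hKK] at hpinch
  have hval : 2 * (β + δ * t) - (β ^ 2 * (N + 2) + 4 * β * δ + 2 * δ ^ 2)
      = t ^ 2 / 2 + (1 - t) ^ 2 / N := by
    rw [hδ, hβ]; field_simp; ring
  rw [hval] at hpinch
  set c : n → ℂ := fun i => if i ∈ S then σ i z else 0 with hc
  have hpt (i j : n) : (E i - E j) ^ 2 * ‖σ i j‖ ^ 2 ≤
      M * (‖σ i j‖ ^ 2 - if (i ∈ S ↔ j ∈ S) ∧ (i = z ↔ j = z) then ‖σ i j‖ ^ 2 else 0) +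
      (W - M) * ((if j = z then ‖c i‖ ^ 2 else 0) + if i = z then ‖c j‖ ^ 2 else 0) := by
    have hs : 0 ≤ ‖σ i j‖ ^ 2 := by positivity
    by_cases hi : i = z
    · by_cases hj : j = z
      · simp [hi, hj, hc, hz]
      · by_cases hjS : j ∈ S
        · have : ‖σ j z‖ = ‖σ z j‖ := by rw [← hσ.1.apply z j, norm_star]
          subst hi
          simp [hj, hjS, hc, hz, hA j hjS, this]
          linarith [mul_le_mul_of_nonneg_right hAz hs]
        · subst hi
          simp [hj, hjS, hc, hz, hB j hjS hj]
          linarith [mul_le_mul_of_nonneg_right hBz hs]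
    · by_cases hiS : i ∈ S
      · by_cases hj : j = z
        · subst hj
          simp [hi, hiS, hc, hz, hA i hiS]
          linarith [mul_le_mul_of_nonneg_right hAz hs]
        · by_cases hjS : j ∈ S
          · simp [hi, hj, hiS, hjS, hA i hiS, hA j hjS]
          · simp [hi, hj, hiS, hjS, hA i hiS, hB j hjS hj]
            linarith [mul_le_mul_of_nonneg_right hAB hs]
      · by_cases hj : j = z
        · subst hj
          simp [hi, hiS, hc, hz, hB i hiS hi]
          linarith [mul_le_mul_of_nonneg_right hBz hs]
        · by_cases hjS : j ∈ S
          · simp [hi, hj, hiS, hjS, hB i hiS hi, hA j hjS]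
            linarith [mul_le_mul_of_nonneg_right hAB hs]
          · simp [hi, hj, hiS, hjS, hB i hiS hi, hB j hjS hj]
  refine ⟨t, (Finset.sum_le_sum fun i _ => Finset.sum_le_sum fun j _ => hpt i j).trans ?_⟩
  simp only [Finset.sum_add_distrib, ← Finset.mul_sum, Finset.sum_sub_distrib]
  have h1 : ∑ i, ∑ j, (if j = z then ‖c i‖ ^ 2 else 0) = C ^ 2 := by
    simpa using hC
  have h2 : ∑ i, ∑ j, (if i = z then ‖c j‖ ^ 2 else 0) = C ^ 2 := by
    rw [Finset.sum_comm]
    simpa using hC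
  rw [h1, h2]
  have hC2 : C ^ 2 ≤ t ^ 2 / 4 := by nlinarith
  nlinarith [mul_le_mul_of_nonneg_left hpinch hM,
    mul_le_mul_of_nonneg_left hC2 (sub_nonneg.2 hMW)]

theorem convexOn_sum_sub_sq_mul (s : n → n → ℝ) (hs : ∀ i j, 0 ≤ s i j) :
    ConvexOn ℝ Set.univ (fun E : n → ℝ => ∑ i, ∑ j, (E i - E j) ^ 2 * s i j) := by
  refine ⟨convex_univ, fun E _ G _ a b ha hb hab => ?_⟩
  simp only [smul_eq_mul, Finset.mul_sum, ← Finset.sum_add_distrib]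
  refine Finset.sum_le_sum fun i _ => Finset.sum_le_sum fun j _ => ?_
  have h : (a * (E i - E j) + b * (G i - G j)) ^ 2
      ≤ a * (E i - E j) ^ 2 + b * (G i - G j) ^ 2 := by
    obtain rfl : b = 1 - a := by linarith
    nlinarith [mul_nonneg (mul_nonneg ha hb) (sq_nonneg ((E i - E j) - (G i - G j)))]
  have h' := mul_le_mul_of_nonneg_right h (hs i j)
  simp only [Pi.add_apply, Pi.smul_apply, smul_eq_mul]
  linear_combination h'

theorem exists_bound_of_segment [DecidableEq n] {σ : Matrix n n ℂ} (hσ : σ.PosSemidef)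
    (htr : σ.trace = 1) (hcard : 2 < Fintype.card n) (E : n → ℝ) {y z : n} (hyz : y ≠ z)
    {B M W : ℝ} (hE : ∀ i, i ≠ y → i ≠ z → E i ∈ segment ℝ (E y) B) (hMW : M ≤ W) (hM : 0 ≤ M)
    (hAz : (E y - E z) ^ 2 ≤ W) (hAB : (E y - B) ^ 2 ≤ M) (hBz : (B - E z) ^ 2 ≤ M) :
    ∃ t : ℝ, ∑ i, ∑ j, (E i - E j) ^ 2 * ‖σ i j‖ ^ 2 ≤ (W - M) * (t ^ 2 / 2) +
      M * (∑ i, ∑ j, ‖σ i j‖ ^ 2 - t ^ 2 / 2 - (1 - t) ^ 2 / ((Fintype.card n : ℝ) - 2)) := by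
  set T : n → Set ℝ := fun i => if i = z then {E z} else if i = y then {E y} else {E y, B} with hT
  have hmem : E ∈ convexHull ℝ (Set.univ.pi T) := by
    rw [convexHull_pi]
    intro i _
    simp only [hT]
    split_ifs with h1 h2
    · simp [h1]
    · simp [h2]
    · rw [convexHull_pair]
      exact hE i h2 h1
  obtain ⟨G, hG, hEG⟩ := (convexOn_sum_sub_sq_mul (fun i j => ‖σ i j‖ ^ 2)
    (fun i j => by positivity)).exists_ge_of_mem_convexHull (Set.subset_univ _) hmem
  have hGz : G z = E z := by simpa [hT] using hG z trivial
  have hGy : G y = E y := by simpa [hT, hyz] using hG y trivial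
  obtain ⟨t, ht⟩ := exists_bound_of_three_levels hσ htr hcard G z
    (S := Finset.univ.filter fun i => i ≠ z ∧ G i = E y) (A := E y) (B := B) (M := M) (W := W)
    ⟨y, by simp [hyz, hGy]⟩ (by simp) (fun i hi => by simpa using (Finset.mem_filter.1 hi).2.2)
    (fun i hi hiz => by
      have hne : G i ≠ E y := by simpa [hiz] using hi
      have hiy : i ≠ y := by rintro rfl; exact hne hGy
      have := hG i trivial
      simp only [hT, if_neg hiz, if_neg hiy] at this
      exact this.resolve_left hne)
    hMW hM (by rwa [hGz]) hAB (by rwa [hGz])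
  exact ⟨t, hEG.trans ht⟩

theorem exists_bound_of_gap [DecidableEq n] {σ : Matrix n n ℂ} (hσ : σ.PosSemidef)
    (htr : σ.trace = 1) (hcard : 2 < Fintype.card n) (E : n → ℝ) {y z : n} (hyz : y ≠ z)
    {u v M : ℝ} (hE : ∀ i, i ≠ y → i ≠ z → E i ∈ Set.Icc u v) (hu : E y < u) (huv : u ≤ v)
    (hv : v < E z) (hgap : E z - E y ≤ 2 * (v - u)) (hM : (v - u) ^ 2 ≤ M)
    (hMW : M ≤ (E z - E y) ^ 2) :
    ∃ t : ℝ, ∑ i, ∑ j, (E i - E j) ^ 2 * ‖σ i j‖ ^ 2 ≤ ((E z - E y) ^ 2 - M) * (t ^ 2 / 2) +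
      M * (∑ i, ∑ j, ‖σ i j‖ ^ 2 - t ^ 2 / 2 - (1 - t) ^ 2 / ((Fintype.card n : ℝ) - 2)) := by
  set E₀ : n → ℝ := fun i => if i = y then E y else if i = z then E z else E i - (u - E y) with hE₀
  set E₁ : n → ℝ := fun i => if i = y then E y else if i = z then E z else E i + (E z - v) with hE₁
  have hy₀ : E₀ y = E y := by simp [hE₀]
  have hz₀ : E₀ z = E z := by simp [hE₀, hyz.symm]
  have hy₁ : E₁ y = E y := by simp [hE₁]
  have hz₁ : E₁ z = E z := by simp [hE₁, hyz.symm]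
  have hM0 : 0 ≤ M := (sq_nonneg _).trans hM
  have hcomp : (E z - E y - (v - u)) ^ 2 ≤ M := by nlinarith
  have hseg : E ∈ segment ℝ E₀ E₁ := by
    have hpos : 0 < (E z - v) + (u - E y) := by linarith
    refine ⟨(E z - v) / ((E z - v) + (u - E y)), (u - E y) / ((E z - v) + (u - E y)),
      div_nonneg (by linarith) hpos.le, div_nonneg (by linarith) hpos.le, ?_, ?_⟩
    · rw [← add_div, div_self hpos.ne']
    · ext i
      simp only [Pi.add_apply, Pi.smul_apply, smul_eq_mul, hE₀, hE₁]
      split_ifs with h1 h2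
      · subst h1; field_simp
      · subst h2; field_simp
      · field_simp; ring
  have hmax := (convexOn_sum_sub_sq_mul (fun i j => ‖σ i j‖ ^ 2)
    (fun i j => by positivity)).le_max_of_mem_segment (Set.mem_univ _) (Set.mem_univ _) hseg
  rcases le_max_iff.1 hmax with h | h
  · obtain ⟨t, ht⟩ := exists_bound_of_segment hσ htr hcard E₀ hyz (B := E y + (v - u)) (M := M)
      (W := (E z - E y) ^ 2) (fun i h1 h2 => by
        have := hE i h1 h2
        rw [hy₀, segment_eq_Icc (by linarith)]
        simp only [hE₀, if_neg h1, if_neg h2]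
        constructor <;> linarith [this.1, this.2]) hMW hM0
      (by rw [hy₀, hz₀]; nlinarith) (by rw [hy₀]; linarith) (by rw [hz₀]; linarith)
    exact ⟨t, h.trans ht⟩
  · obtain ⟨t, ht⟩ := exists_bound_of_segment hσ htr hcard E₁ hyz.symm (B := E z - (v - u))
      (M := M) (W := (E z - E y) ^ 2) (fun i h1 h2 => by
        have := hE i h2 h1
        rw [hz₁, segment_symm, segment_eq_Icc (by linarith)]
        simp only [hE₁, if_neg h1, if_neg h2]
        constructor <;> linarith [this.1, this.2]) hMW hM0
      (by rw [hy₁, hz₁]) (by rw [hz₁]; linarith) (by rw [hy₁]; linarith)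
    exact ⟨t, h.trans ht⟩

end

/-- The weight `p` of each extremal level and the weight `q` of each middle level in the optimal
state, together with the relations which the purity window forces on them. -/
theorem purity_window_weights {N κ γ x : ℝ} (hN : 0 < N) (hγ0 : 0 < γ) (hγ : γ < 2)
    (hlow : 1 / (N + 2) + 2 / (N + 2) ^ 2 ≤ κ)
    (hupp : κ ≤ (4 + N * (2 - γ) ^ 2) / (2 * (N + 1) - N * γ) ^ 2)
    (hx : x = N / (2 * (N + 2) * (N + 1)) *
      (-1 + (N + 2) * Real.sqrt ((-1 + (N + 1) * κ) / N))) :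
    ∃ p q : ℝ, 1 / (N + 2) + x = p ∧ 1 / (N + 2) - 2 * x / N = q ∧ 2 * p + N * q = 1 ∧
      4 * p ^ 2 + N * q ^ 2 = κ ∧ 0 < q ∧ q ≤ p ∧ (2 - γ) * p ≤ q := by
  set R := Real.sqrt ((-1 + (N + 1) * κ) / N) with hR
  have hD : 0 < 2 * (N + 1) - N * γ := by nlinarith
  have hrad : 1 / (N + 2) ^ 2 ≤ (-1 + (N + 1) * κ) / N := by
    rw [le_div_iff₀ hN]
    have h := mul_le_mul_of_nonneg_left hlow (by linarith : 0 ≤ N + 1)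
    have : (N + 1) * (1 / (N + 2) + 2 / (N + 2) ^ 2) = 1 + 1 / (N + 2) ^ 2 * N := by
      field_simp; ring
    linarith
  have hR1 : 1 / (N + 2) ≤ R := by
    apply Real.le_sqrt_of_sq_le
    rwa [div_pow, one_pow]
  have hR2 : R ≤ γ / (2 * (N + 1) - N * γ) := by
    apply Real.sqrt_le_iff.2 ⟨by positivity, ?_⟩
    rw [div_le_iff₀ hN]
    have h := mul_le_mul_of_nonneg_left hupp (by linarith : 0 ≤ N + 1)
    have : (N + 1) * ((4 + N * (2 - γ) ^ 2) / (2 * (N + 1) - N * γ) ^ 2)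
        = 1 + (γ / (2 * (N + 1) - N * γ)) ^ 2 * N := by
      have hD' := hD.ne'
      rw [div_pow, ← mul_div_assoc, ← mul_div_right_comm,
        div_eq_iff (pow_ne_zero 2 hD'), add_mul (1 : ℝ), div_mul_cancel₀ _ (pow_ne_zero 2 hD')]
      ring
    linarith
  have hRsq : R ^ 2 * N = -1 + (N + 1) * κ := by
    rw [hR, Real.sq_sqrt (le_trans (by positivity) hrad)]
    field_simp
  rw [le_div_iff₀ hD] at hR2
  rw [div_le_iff₀ (by linarith)] at hR1
  have hRlt : R < 1 := by
    by_contra! hcon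
    nlinarith
  have hp : 1 / (N + 2) + x = (1 + N * R) / (2 * (N + 1)) := by
    rw [hx]; field_simp; ring
  have hq : 1 / (N + 2) - 2 * x / N = (1 - R) / (N + 1) := by
    rw [hx]; field_simp; ring
  refine ⟨(1 + N * R) / (2 * (N + 1)), (1 - R) / (N + 1), hp, hq, by field_simp; ring, ?_,
    div_pos (by linarith) (by linarith), ?_, ?_⟩
  · have hκ : κ = (R ^ 2 * N + 1) / (N + 1) := by
      rw [hRsq]; field_simp; ring
    rw [hκ]; field_simp; ring
  · rw [div_le_div_iff₀ (by linarith) (by linarith)]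
    nlinarith
  · rw [← mul_div_assoc, div_le_div_iff₀ (by linarith) (by linarith)]
    nlinarith

theorem weight_bound_le {N p q W M κ t : ℝ} (hN : 0 < N) (hpq : 2 * p + N * q = 1)
    (hκ : 4 * p ^ 2 + N * q ^ 2 = κ) (hq : 0 < q) (hqp : q ≤ p) (hW : 0 ≤ W)
    (hM : M = p / (2 * p - q) * W) :
    (W - M) * (t ^ 2 / 2) + M * (κ - t ^ 2 / 2 - (1 - t) ^ 2 / N) ≤ 2 * p ^ 2 * W := by
  have hD : 0 < 2 * p - q := by linarith
  have hid : 2 * p ^ 2 * W - ((W - M) * (t ^ 2 / 2) + M * (κ - t ^ 2 / 2 - (1 - t) ^ 2 / N))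
      = W * (q / (2 * (2 * p - q)) + p / (2 * p - q) / N) * (t - 2 * p) ^ 2 := by
    rw [hM, ← hκ]
    obtain rfl : N = (1 - 2 * p) / q := by field_simp; linarith
    have h1 : 1 - 2 * p ≠ 0 := by
      intro h; rw [h] at hN; simp at hN
    field_simp
    ring
  have : 0 ≤ W * (q / (2 * (2 * p - q)) + p / (2 * p - q) / N) * (t - 2 * p) ^ 2 := by
    have : 0 < p := by linarith
    positivity
  linarith

section
variable {n : Type*} [Fintype n] [DecidableEq n]

theorem two_level_vector_sum {y z : n} (hyz : y ≠ z) {w : ℂ} (hw : star w * w = 1) {Ψ : n → ℂ}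
    (hΨ : Ψ = ((Real.sqrt 2 : ℂ))⁻¹ • ((Pi.single y 1 : n → ℂ) + w • (Pi.single z 1 : n → ℂ)))
    (e : n → ℂ) : ∑ i, star (Ψ i) * (e i * Ψ i) = (e y + e z) / 2 := by
  have h2 : ((Real.sqrt 2 : ℝ) : ℂ) ^ 2 = 2 := by
    rw [← Complex.ofReal_pow, Real.sq_sqrt (by norm_num)]; norm_num
  have h20 : ((Real.sqrt 2 : ℝ) : ℂ) ≠ 0 := by
    intro h; rw [h] at h2; norm_num at h2
  have hy : Ψ y = ((Real.sqrt 2 : ℂ))⁻¹ := by simp [hΨ, hyz]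
  have hz : Ψ z = ((Real.sqrt 2 : ℂ))⁻¹ * w := by simp [hΨ, hyz.symm]
  have h0 (i : n) (h1 : i ≠ y) (h2 : i ≠ z) : Ψ i = 0 := by simp [hΨ, h1, h2]
  rw [Finset.sum_eq_add_of_mem y z (Finset.mem_univ _) (Finset.mem_univ _) hyz
    (fun i _ hi => by simp [h0 i hi.1 hi.2]), hy, hz]
  simp only [star_mul', star_inv₀, Complex.star_def, Complex.conj_ofReal] at hw ⊢
  have hinv : (((Real.sqrt 2 : ℝ) : ℂ))⁻¹ * (((Real.sqrt 2 : ℝ) : ℂ))⁻¹ = 1 / 2 := by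
    rw [← mul_inv, ← sq, h2]; norm_num
  linear_combination (e y + e z) * hinv + 
    e z * ((((Real.sqrt 2 : ℝ) : ℂ))⁻¹ * (((Real.sqrt 2 : ℝ) : ℂ))⁻¹) * hw

theorem two_level_state_properties {y z : n} (hyz : y ≠ z) {w : ℂ} (hw : star w * w = 1)
    {Ψ : n → ℂ}
    (hΨ : Ψ = ((Real.sqrt 2 : ℂ))⁻¹ • ((Pi.single y 1 : n → ℂ) + w • (Pi.single z 1 : n → ℂ)))
    {p q : ℝ} (hp : 0 ≤ p) (hq : 0 ≤ q) (E : n → ℝ) {ρ : Matrix n n ℂ}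
    (hρ : ρ = ((2 * p : ℝ) : ℂ) • vecMulVec Ψ (star Ψ) +
      (q : ℂ) • diagonal (fun i => if i = y ∨ i = z then 0 else 1)) :
    ρ.PosSemidef ∧ ρ.trace = ((2 * p + (Fintype.card n - 2) * q : ℝ) : ℂ) ∧
    (ρ * ρ).trace = ((4 * p ^ 2 + (Fintype.card n - 2) * q ^ 2 : ℝ) : ℂ) ∧
    -(((diagonal (fun i => (E i : ℂ)) * ρ - ρ * diagonal (fun i => (E i : ℂ))) *
      (diagonal (fun i => (E i : ℂ)) * ρ - ρ * diagonal (fun i => (E i : ℂ)))).trace)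
      = ((2 * p ^ 2 * (E z - E y) ^ 2 : ℝ) : ℂ) := by
  set D : Matrix n n ℂ := diagonal (fun i => if i = y ∨ i = z then 0 else 1) with hD
  set H : Matrix n n ℂ := diagonal (fun i => (E i : ℂ)) with hH
  set P : Matrix n n ℂ := vecMulVec Ψ (star Ψ) with hP
  have hsum := two_level_vector_sum hyz hw hΨ
  have h1 : star Ψ ⬝ᵥ Ψ = 1 := by
    have := hsum (fun _ => 1)
    simpa [dotProduct] using this
  have hPP : P * P = P := by simp [hP, vecMulVec_mul_vecMulVec, h1]
  have hΨ0 (i : n) (h1 : i ≠ y) (h2 : i ≠ z) : Ψ i = 0 := by simp [hΨ, h1, h2]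
  have hDP : D * P = 0 := by
    ext i j
    by_cases h : i = y ∨ i = z
    · simp [hD, diagonal_mul, h]
    · simp [hD, diagonal_mul, hP, vecMulVec_apply, hΨ0 i (fun h' => h (.inl h'))
        (fun h' => h (.inr h'))]
  have hPD : P * D = 0 := by
    ext i j
    by_cases h : j = y ∨ j = z
    · simp [hD, mul_diagonal, h]
    · simp [hD, mul_diagonal, hP, vecMulVec_apply, hΨ0 j (fun h' => h (.inl h'))
        (fun h' => h (.inr h'))]
  have hDD : D * D = D := by
    simp [hD, diagonal_mul_diagonal]
  have hPtr : P.trace = 1 := by rw [hP, trace_vecMulVec, dotProduct_comm, h1]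
  have hDtr : D.trace = (Fintype.card n : ℂ) - 2 := by
    have : (fun i : n => if i = y ∨ i = z then (0 : ℂ) else 1)
        = fun i => 1 - ((if i = y then 1 else 0) + if i = z then 1 else 0) := by
      ext i
      by_cases h1 : i = y
      · simp [h1, hyz]
      · by_cases h2 : i = z <;> simp [h1, h2, hyz.symm]
    rw [hD, trace_diagonal, this, Finset.sum_sub_distrib, Finset.sum_add_distrib]
    simp
    norm_num
  have hHD : H * D = D * H := by
    simp [hD, hH, diagonal_mul_diagonal]
  refine ⟨?_, ?_, ?_, ?_⟩
  · rw [hρ]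
    refine ((posSemidef_vecMulVec_self_star Ψ).smul ?_).add (PosSemidef.smul ?_ ?_)
    · exact_mod_cast (by positivity : (0 : ℝ) ≤ 2 * p)
    · refine PosSemidef.diagonal fun i => ?_
      dsimp only
      split_ifs <;> simp
    · exact_mod_cast hq
  · rw [hρ, trace_add, trace_smul, trace_smul, hPtr, hDtr]
    simp
    ring
  · rw [hρ]
    simp only [add_mul, mul_add, smul_mul_assoc, Matrix.mul_smul, hPP, hDP, hPD, hDD, trace_add,
      trace_smul, hPtr, hDtr, trace_zero, smul_eq_mul, smul_zero]
    push_cast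
    ring
  · have hcomm : H * ρ - ρ * H = ((2 * p : ℝ) : ℂ) • (H * P - P * H) := by
      rw [hρ, mul_add, add_mul, smul_mul_assoc, smul_mul_assoc, Matrix.mul_smul, Matrix.mul_smul,
        hHD, smul_sub]
      abel
    have hm1 : star Ψ ⬝ᵥ (H *ᵥ Ψ) = ((E y : ℂ) + E z) / 2 := by
      rw [← hsum (fun i => (E i : ℂ))]
      simp [dotProduct, hH, mulVec_diagonal]
    have hm1' : (star Ψ ᵥ* H) ⬝ᵥ Ψ = ((E y : ℂ) + E z) / 2 := by
      rw [← dotProduct_mulVec, hm1]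
    have hm2 : (star Ψ ᵥ* H) ⬝ᵥ (H *ᵥ Ψ) = ((E y : ℂ) ^ 2 + E z ^ 2) / 2 := by
      rw [← hsum (fun i => (E i : ℂ) ^ 2)]
      simp only [dotProduct, hH, mulVec_diagonal, vecMul_diagonal, Pi.star_apply]
      exact Finset.sum_congr rfl fun i _ => by ring
    rw [hcomm, smul_mul_assoc, Matrix.mul_smul, trace_smul, trace_smul, hP, mul_vecMulVec,
      vecMulVec_mul]
    simp only [sub_mul, mul_sub, vecMulVec_mul_vecMulVec, trace_sub, trace_vecMulVec, hm1, hm1',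
      hm2, h1, one_smul, smul_eq_mul, trace_smul, vecMulVec_smul,
      dotProduct_comm Ψ, dotProduct_comm (H *ᵥ Ψ)]
    push_cast
    ring

end

/-- For `d ≥ 4`, strictly increasing energies with
`γ₁ = (E_d − E₁)²/(E_{d−1} − E₂)² < 2`, and purity `κ ∈ [1/d + 2/d², κ₁]` where
`κ₁ = (4 + (d−2)(2−γ₁)²)/(2(d−1) − (d−2)γ₁)²`, every density matrix `σ` of purity `κ`
has squared speed at most `2(1/d + x)²(E_d − E₁)²`, and the bound is attained by
`ρ_κ = 2(1/d+x)|Ψ₁⟩⟨Ψ₁| + (1/d − 2x/(d−2))Σ_{i=2}^{d−1}|e_i⟩⟨e_i|`. -/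
theorem optimal_speed_bound_gamma_lt_two_low {d : ℕ} (hd : 4 ≤ d)
    (E : Fin d → ℝ) (hE : StrictMono E)
    (γ₁ : ℝ)
    (hγ₁def : γ₁ = (E (⟨d - 1, by omega⟩ : Fin d) - E (⟨0, by omega⟩ : Fin d))^2
        / (E (⟨d - 2, by omega⟩ : Fin d) - E (⟨1, by omega⟩ : Fin d))^2)
    (hγ₁lt : γ₁ < 2)
    (κ₁ : ℝ)
    (hκ₁ : κ₁ = (4 + ((d : ℝ) - 2) * (2 - γ₁)^2)
        / (2 * ((d : ℝ) - 1) - ((d : ℝ) - 2) * γ₁)^2)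
    (H : Matrix (Fin d) (Fin d) ℂ)
    (hH : H = Matrix.diagonal fun i => (E i : ℂ))
    (κ : ℝ) (hκ : κ ∈ Set.Icc (1 / (d : ℝ) + 2 / (d : ℝ)^2) κ₁)
    (θ : ℝ) (x : ℝ)
    (hx : x = ((d : ℝ) - 2) / (2 * d * ((d : ℝ) - 1))
        * (-1 + (d : ℝ) * Real.sqrt ((-1 + ((d : ℝ) - 1) * κ) / ((d : ℝ) - 2))))
    (Ψ : Fin d → ℂ)
    (hΨ : Ψ = ((Real.sqrt 2 : ℂ))⁻¹ •
        ((Pi.single (⟨0, by omega⟩ : Fin d) 1 : Fin d → ℂ)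
          + Complex.exp (-(θ : ℂ) * Complex.I) • (Pi.single (⟨d - 1, by omega⟩ : Fin d) 1 : Fin d → ℂ)))
    (ρκ : Matrix (Fin d) (Fin d) ℂ)
    (hρκ : ρκ = ((2 * (1 / (d : ℝ) + x) : ℝ) : ℂ) • Matrix.vecMulVec Ψ (star Ψ)
        + ((1 / (d : ℝ) - 2 * x / ((d : ℝ) - 2) : ℝ) : ℂ) •
            Matrix.diagonal (fun i : Fin d =>
              if i = (⟨0, by omega⟩ : Fin d) ∨ i = (⟨d - 1, by omega⟩ : Fin d) then 0 else 1)) :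
    (∀ σ : Matrix (Fin d) (Fin d) ℂ,
        σ.PosSemidef → σ.trace = 1 → (σ * σ).trace = (κ : ℂ) →
        (-(((H * σ - σ * H) * (H * σ - σ * H)).trace)).re
          ≤ 2 * (1 / (d : ℝ) + x)^2
              * (E (⟨d - 1, by omega⟩ : Fin d) - E (⟨0, by omega⟩ : Fin d))^2)
    ∧ ρκ.PosSemidef ∧ ρκ.trace = 1 ∧ (ρκ * ρκ).trace = (κ : ℂ)
    ∧ -(((H * ρκ - ρκ * H) * (H * ρκ - ρκ * H)).trace)
        = ((2 * (1 / (d : ℝ) + x)^2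
            * (E (⟨d - 1, by omega⟩ : Fin d) - E (⟨0, by omega⟩ : Fin d))^2 : ℝ) : ℂ) := by
  have hd' : (4 : ℝ) ≤ d := by exact_mod_cast hd
  obtain ⟨N, hN⟩ : ∃ N : ℝ, (d : ℝ) = N + 2 := ⟨d - 2, by ring⟩
  have hNpos : 0 < N := by linarith
  set y : Fin d := ⟨0, by omega⟩ with hy
  set z : Fin d := ⟨d - 1, by omega⟩ with hz
  set y' : Fin d := ⟨1, by omega⟩ with hy'
  set z' : Fin d := ⟨d - 2, by omega⟩ with hz'
  have hyz : y ≠ z := by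
    simp only [hy, hz, ne_eq, Fin.mk.injEq]; omega
  have hyy' : E y < E y' := hE (by simp only [hy, hy', Fin.mk_lt_mk]; omega)
  have hy'z' : E y' < E z' := hE (by simp only [hy', hz', Fin.mk_lt_mk]; omega)
  have hz'z : E z' < E z := hE (by simp only [hz', hz, Fin.mk_lt_mk]; omega)
  have hgap0 : 0 < (E z' - E y') ^ 2 := pow_pos (sub_pos.2 hy'z') 2
  have hW : 0 < (E z - E y) ^ 2 := pow_pos (by linarith) 2
  have hγ0 : 0 < γ₁ := by rw [hγ₁def]; positivity
  have hγW : γ₁ * (E z' - E y') ^ 2 = (E z - E y) ^ 2 := by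
    rw [hγ₁def, div_mul_cancel₀ _ hgap0.ne']
  rw [hN] at hx hρκ ⊢
  rw [hN, Set.mem_Icc, hκ₁, hN, add_sub_cancel_right, show N + 2 - 1 = N + 1 by ring] at hκ
  rw [add_sub_cancel_right, show N + 2 - 1 = N + 1 by ring] at hx
  obtain ⟨p, q, hp, hq, hpq, hκpq, hq0, hqp, hγpq⟩ := purity_window_weights (N := N) (κ := κ)
    (γ := γ₁) (x := x) hNpos hγ0 hγ₁lt hκ.1 hκ.2 hx
  have hw : star (Complex.exp (-(θ : ℂ) * Complex.I)) * Complex.exp (-(θ : ℂ) * Complex.I)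
      = 1 := by
    rw [Complex.star_def, Complex.conj_mul', ← Complex.ofReal_neg, Complex.norm_exp_ofReal_mul_I]
    simp
  have hcard : (Fintype.card (Fin d) : ℝ) - 2 = N := by
    rw [Fintype.card_fin, hN]; ring
  rw [add_sub_cancel_right, hp, hq] at hρκ
  obtain ⟨hpsd, htr, hpur, hspeed⟩ := two_level_state_properties hyz hw hΨ (by linarith : 0 ≤ p)
    hq0.le E hρκ
  rw [hcard] at htr hpur
  rw [hpq] at htr
  rw [hκpq] at hpur
  rw [hp, hH]
  refine ⟨fun σ hσ hσtr hσpur => ?_, hpsd, by simpa using htr, hpur, hspeed⟩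
  rw [neg_trace_commutator_sq_eq_sum E hσ.1, Complex.ofReal_re]
  rw [trace_mul_self_eq_sum_normSq hσ.1, Complex.ofReal_inj] at hσpur
  have hden : 0 < 2 * p - q := by linarith
  have hMlow : (E z' - E y') ^ 2 ≤ p / (2 * p - q) * (E z - E y) ^ 2 := by
    rw [← hγW, ← mul_assoc]
    refine le_mul_of_one_le_left hgap0.le ?_
    rw [← mul_div_right_comm, one_le_div hden]
    linarith
  have hMupp : p / (2 * p - q) * (E z - E y) ^ 2 ≤ (E z - E y) ^ 2 := by
    refine mul_le_of_le_one_left hW.le ?_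
    rw [div_le_one hden]
    linarith
  have hmid (i : Fin d) (h1 : i ≠ y) (h2 : i ≠ z) : E i ∈ Set.Icc (E y') (E z') := by
    have h1' : (i : ℕ) ≠ 0 := fun h => h1 (Fin.ext h)
    have h2' : (i : ℕ) ≠ d - 1 := fun h => h2 (Fin.ext h)
    constructor <;> refine hE.monotone ?_ <;> rw [Fin.le_def] <;> simp only [hy', hz'] <;> omega
  obtain ⟨t, ht⟩ := exists_bound_of_gap hσ hσtr (by rw [Fintype.card_fin]; omega) E hyz hmid hyy'
    hy'z'.le hz'z (by nlinarith) hMlow hMupp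
  rw [hσpur, hcard] at ht
  exact ht.trans (weight_bound_le hNpos hpq hκpq hq0 hqp hW.le rfl)
end

section
/- Let d₁, d₂ ≥ 2, d = d₁d₂ (so d ≥ 4), index ℂ^d by pairs (a,b) ∈ {0,…,d₁−1} × {0,…,d₂−1}, and let x ∈ (0, (d−2)/(2d)]. Let Ψ₁ := (|0,0⟩ + e^{−iθ}|d₁−1, d₂−1⟩)/√2 and ρ := 2(1/d + x)|Ψ₁⟩⟨Ψ₁| + (1/d − 2x/(d−2))·Σ_{(a,b) ∉ {(0,0),(d₁−1,d₂−1)}} |a,b⟩⟨a,b|. Define the partial transpose ρ^{T₁} entrywise by (ρ^{T₁})_{(a,b),(a',b')} := ρ_{(a',b),(a,b')}. Then the eigenvalues of the Hermitian matrix ρ^{T₁} are: 1/d + x with multiplicity 2, 1/d − 2x/(d−2) with multiplicity d−4, 2/d + x(d−4)/(d−2) with multiplicity 1, and −x·d/(d−2) with multiplicity 1. In particular ρ^{T₁} has exactly one negative eigenvalue, so ρ is an entangled bipartite state with negativity 2xd/(d−2). -/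
open Matrix Complex Kronecker
open scoped ComplexOrder

namespace Matrix

section Charpoly

variable {n : Type*} [Fintype n] [DecidableEq n]

lemma diagonal_mul_single {R : Type*} [Semiring R] (f : n → R) (i j : n) (a : R) :
    diagonal f * single i j a = single i j (f i * a) := by
  ext k l
  simp only [diagonal_mul, single_apply]
  split_ifs with h
  · rw [h.1]
  · simp

lemma single_mul_diagonal {R : Type*} [Semiring R] (f : n → R) (i j : n) (a : R) :
    single i j a * diagonal f = single i j (a * f j) := by
  ext k l
  simp only [mul_diagonal, single_apply]
  split_ifs with h
  · rw [h.2]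
  · simp

/-- A matrix that is diagonal except for one `2 × 2` block `!![e, c * z; c * w, e]` with
`z * w = 1` has the characteristic polynomial of the diagonal matrix in which the block is
replaced by `e + c` and `e - c`. -/
lemma charpoly_diagonal_add_single_add_single {u v : n} (huv : u ≠ v) (f : n → ℂ)
    (hf : f u = f v) (c z w : ℂ) (hzw : z * w = 1) :
    (diagonal f + single u v (c * z) + single v u (c * w)).charpoly =
      (diagonal (f + Pi.single u c - Pi.single v c)).charpoly := by
  have hD : diagonal (f + Pi.single u c - Pi.single v c) =
      diagonal f + single u u c - single v v c := by
    rw [← diagonal_single u c, ← diagonal_single v c, diagonal_add, diagonal_sub]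
    rfl
  set D := diagonal (f + Pi.single u c - Pi.single v c)
  set M := diagonal f + single u v (c * z) + single v u (c * w)
  set P : Matrix n n ℂ := transvection v u w * transvection u v (-(z / 2)) with hP
  have hdet : IsUnit P.det := by
    simp [hP, det_transvection_of_ne _ _ huv, det_transvection_of_ne _ _ huv.symm]
  have hP' : P = 1 + single v u w + single u v (-(z / 2)) + single v v (-(1 / 2)) := by
    have h : w * -(z / 2) = -(1 / 2) := by linear_combination -hzw / 2
    simp only [hP, transvection, add_mul, mul_add, one_mul, mul_one, single_mul_single_same, h]
    abel
  have hMP : M * P = P * D := by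
    have h1 : c * z * w = c := by rw [mul_assoc, hzw, mul_one]
    have h2 : c * w * -(z / 2) = -(c / 2) := by linear_combination -c * hzw / 2
    rw [hP', hD]
    simp only [M, add_mul, mul_add, mul_sub, one_mul, mul_one, single_mul_single_same,
      single_mul_single_of_ne _ _ _ _ huv, single_mul_single_of_ne _ _ _ _ huv.symm,
      diagonal_mul_single, single_mul_diagonal, h1, h2]
    ext k l
    simp only [add_apply, sub_apply, single_apply, zero_apply, hf]
    split_ifs <;> ring
  obtain ⟨U, hU⟩ := (isUnit_iff_isUnit_det P).2 hdet
  have : M = U.val * D * U.val⁻¹ := by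
    rw [hU, ← hMP, mul_nonsing_inv_cancel_right _ _ hdet]
  rw [this, charpoly_units_conj]

lemma IsHermitian.map_eigenvalues_of_charpoly_eq {A : Matrix n n ℂ} (hA : A.IsHermitian)
    (g : n → ℝ) (h : A.charpoly = (diagonal fun i => (g i : ℂ)).charpoly) :
    Finset.univ.val.map hA.eigenvalues = Finset.univ.val.map g := by
  have h1 := hA.roots_charpoly_eq_eigenvalues
  rw [h, charpoly_diagonal, Polynomial.roots_prod _ _
    (Finset.prod_ne_zero_iff.2 fun i _ => Polynomial.X_sub_C_ne_zero _)] at h1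
  simp only [Polynomial.roots_X_sub_C, Multiset.bind_singleton] at h1
  apply Multiset.map_injective Complex.ofReal_injective
  rw [Multiset.map_map, Multiset.map_map]
  exact h1.symm

lemma map_univ_val_add_single_sub_single {p q u v : n} (hpq : p ≠ q)
    (hpu : p ≠ u) (hpv : p ≠ v) (hqu : q ≠ u) (hqv : q ≠ v) (huv : u ≠ v) (c e : ℝ) :
    Finset.univ.val.map
        ((fun i => if i = p ∨ i = q then c else e) + Pi.single u c - Pi.single v c : n → ℝ) =
      Multiset.replicate 2 c + Multiset.replicate (Fintype.card n - 4) e +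
        Multiset.replicate 1 (e + c) + Multiset.replicate 1 (e - c) := by
  set s : Finset n := {p, q, u, v} with hs
  have hsv : s.val = p ::ₘ q ::ₘ u ::ₘ v ::ₘ 0 := by
    simp [s, *]
  have hcard : sᶜ.card = Fintype.card n - 4 := by
    rw [Finset.card_compl, Finset.card_def, hsv]
    rfl
  have huniv : (Finset.univ : Finset n).val = s.val + sᶜ.val := by
    rw [← Finset.disjUnion_val _ _ disjoint_compl_right, Finset.disjUnion_eq_union,
      Finset.union_compl]
  have hrest : sᶜ.val.map
      ((fun i => if i = p ∨ i = q then c else e) + Pi.single u c - Pi.single v c : n → ℝ) =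
      Multiset.replicate (Fintype.card n - 4) e := by
    rw [← hcard, Finset.card_def, ← Multiset.map_const']
    refine Multiset.map_congr rfl fun i hi => ?_
    have : i ∉ s := by simpa using hi
    simp only [hs, Finset.mem_insert, Finset.mem_singleton, not_or] at this
    simp [this]
  rw [huniv, Multiset.map_add, hrest, hsv]
  simp only [Multiset.map_cons, Multiset.map_zero, Pi.add_apply, Pi.sub_apply, Pi.single_apply]
  simp only [hpu, hpv, hqu, hqv, huv, hpu.symm, hpv.symm, hqu.symm, hqv.symm, huv.symm, or_true,
    true_or, or_false, if_true, if_false, add_zero, sub_zero, Multiset.replicate_succ,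
    Multiset.replicate_zero, Multiset.cons_add, zero_add]
  simp only [← Multiset.singleton_add]
  abel

end Charpoly

section PartialTranspose

variable {m n : Type*}

/-- The partial transpose of a matrix over a product index type in the first factor. -/
def partialTranspose (ρ : Matrix (m × n) (m × n) ℂ) : Matrix (m × n) (m × n) ℂ :=
  of fun p q => ρ (q.1, p.2) (p.1, q.2)

lemma IsHermitian.partialTranspose {ρ : Matrix (m × n) (m × n) ℂ} (h : ρ.IsHermitian) :
    ρ.partialTranspose.IsHermitian := by
  ext p q
  exact h.apply _ _

/-- The partial transpose of a separable operator is positive semidefinite. -/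
lemma posSemidef_partialTranspose_of_separable [Fintype m] [Fintype n] {ι : Type*}
    [Fintype ι] (w : ι → ℝ)
    (A : ι → Matrix m m ℂ) (B : ι → Matrix n n ℂ) (hw : ∀ i, 0 ≤ w i)
    (hA : ∀ i, (A i).PosSemidef) (hB : ∀ i, (B i).PosSemidef) :
    (∑ i, ((w i : ℝ) : ℂ) • (A i ⊗ₖ B i)).partialTranspose.PosSemidef := by
  have h : (∑ i, ((w i : ℝ) : ℂ) • (A i ⊗ₖ B i)).partialTranspose =
      ∑ i, ((w i : ℝ) : ℂ) • ((A i)ᵀ ⊗ₖ B i) := by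
    ext p q
    simp [partialTranspose, Matrix.sum_apply]
  rw [h]
  exact posSemidef_sum _ fun i _ =>
    ((hA i).transpose.kronecker (hB i)).smul (by exact_mod_cast hw i)

lemma partialTranspose_add (A B : Matrix (m × n) (m × n) ℂ) :
    (A + B).partialTranspose = A.partialTranspose + B.partialTranspose := rfl

lemma partialTranspose_smul (a : ℂ) (A : Matrix (m × n) (m × n) ℂ) :
    (a • A).partialTranspose = a • A.partialTranspose := rfl

lemma partialTranspose_diagonal [DecidableEq m] [DecidableEq n] (f : m × n → ℂ) :
    (diagonal f).partialTranspose = diagonal f := by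
  ext ⟨a, b⟩ ⟨a', b'⟩
  simp only [partialTranspose, of_apply, diagonal_apply, Prod.mk.injEq]
  grind

lemma partialTranspose_single [DecidableEq m] [DecidableEq n] (i i' : m) (j j' : n) (a : ℂ) :
    (single (i, j) (i', j') a).partialTranspose = single (i', j) (i, j') a := by
  ext ⟨k, l⟩ ⟨k', l'⟩
  simp only [partialTranspose, of_apply, single_apply, Prod.mk.injEq]
  grind

lemma partialTranspose_pure_add_diagonal [DecidableEq m] [DecidableEq n]
    {i₀ i₁ : m} {j₀ j₁ : n} (hj : j₀ ≠ j₁)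
    (c e s ζ : ℂ) (hs : 2 * (s * star s) = 1) (hζ : ζ * star ζ = 1) :
    ((2 * c) • vecMulVec (s • (Pi.single (i₀, j₀) 1 + ζ • Pi.single (i₁, j₁) 1 : m × n → ℂ))
          (star (s • (Pi.single (i₀, j₀) 1 + ζ • Pi.single (i₁, j₁) 1 : m × n → ℂ)))
        + e • diagonal (fun p : m × n =>
          if p = (i₀, j₀) ∨ p = (i₁, j₁) then 0 else 1)).partialTranspose =
      diagonal (fun p : m × n => if p = (i₀, j₀) ∨ p = (i₁, j₁) then c else e)
        + single (i₁, j₀) (i₀, j₁) (c * star ζ) + single (i₀, j₁) (i₁, j₀) (c * ζ) := by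
  have hsplit : (2 * c) • vecMulVec (s • (Pi.single (i₀, j₀) 1 + ζ • Pi.single (i₁, j₁) 1))
        (star (s • (Pi.single (i₀, j₀) 1 + ζ • Pi.single (i₁, j₁) 1 : m × n → ℂ))) =
      single (i₀, j₀) (i₀, j₀) c + single (i₀, j₀) (i₁, j₁) (c * star ζ) +
        single (i₁, j₁) (i₀, j₀) (c * ζ) + single (i₁, j₁) (i₁, j₁) c := by
    simp only [star_smul, star_add, Pi.star_single, star_one, vecMulVec_smul, smul_vecMulVec,
      add_vecMulVec, vecMulVec_add, ← single_eq_single_vecMulVec_single, smul_add, smul_smul,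
      smul_single, smul_eq_mul, mul_one]
    have h₀₀ : 2 * c * (star s * s) = c := by linear_combination c * hs
    have h₁₀ : 2 * c * (star s * (s * ζ)) = c * ζ := by linear_combination c * ζ * hs
    have h₀₁ : 2 * c * (star (s * ζ) * s) = c * star ζ := by
      rw [StarMul.star_mul]
      linear_combination c * star ζ * hs
    have h₁₁ : 2 * c * (star (s * ζ) * (s * ζ)) = c := by
      rw [StarMul.star_mul]
      linear_combination c * hs + 2 * c * s * star s * hζ
    rw [h₀₀, h₁₀, h₀₁, h₁₁]
    abel
  rw [hsplit]
  simp only [partialTranspose_add, partialTranspose_single, partialTranspose_smul,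
    partialTranspose_diagonal]
  have hdiag : diagonal (fun p : m × n => if p = (i₀, j₀) ∨ p = (i₁, j₁) then c else e) =
      single (i₀, j₀) (i₀, j₀) c + single (i₁, j₁) (i₁, j₁) c + e • diagonal (fun p : m × n =>
        if p = (i₀, j₀) ∨ p = (i₁, j₁) then 0 else 1) := by
    rw [← diagonal_single, ← diagonal_single, ← diagonal_smul, diagonal_add, diagonal_add]
    congr 1
    ext p
    simp only [Pi.single_apply, Pi.smul_apply, smul_eq_mul]
    grind
  rw [hdiag]
  abel

end PartialTranspose

end Matrix

/-- For the optimal state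
`ρ = 2(1/d + x)|Ψ₁⟩⟨Ψ₁| + (1/d − 2x/(d−2))Σ_{(a,b)≠(0,0),(d₁−1,d₂−1)}|a,b⟩⟨a,b|` with
`x ∈ (0, (d−2)/(2d)]`, the partial transpose `ρ^{T₁}` has eigenvalues `1/d + x`
(multiplicity 2), `1/d − 2x/(d−2)` (multiplicity d−4), `2/d + x(d−4)/(d−2)`
(multiplicity 1), and `−xd/(d−2)` (multiplicity 1); in particular it has exactly one
negative eigenvalue, `ρ` is entangled, and its negativity (twice the absolute sum of
the negative eigenvalues of `ρ^{T₁}`) equals `2xd/(d−2)`. -/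
theorem partial_transpose_spectrum_of_optimal_state {d₁ d₂ : ℕ}
    (hd₁ : 2 ≤ d₁) (hd₂ : 2 ≤ d₂)
    (θ : ℝ) (x : ℝ)
    (hx : 0 < x ∧ x ≤ (((d₁ : ℝ) * d₂) - 2) / (2 * ((d₁ : ℝ) * d₂)))
    (Ψ : Fin d₁ × Fin d₂ → ℂ)
    (hΨ : Ψ = ((Real.sqrt 2 : ℂ))⁻¹ •
        ((Pi.single ((⟨0, by omega⟩ : Fin d₁), (⟨0, by omega⟩ : Fin d₂)) 1 : Fin d₁ × Fin d₂ → ℂ)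
          + Complex.exp (-(θ : ℂ) * Complex.I) •
            (Pi.single ((⟨d₁ - 1, by omega⟩ : Fin d₁), (⟨d₂ - 1, by omega⟩ : Fin d₂)) 1 : Fin d₁ × Fin d₂ → ℂ)))
    (ρ : Matrix (Fin d₁ × Fin d₂) (Fin d₁ × Fin d₂) ℂ)
    (hρ : ρ = ((2 * (1 / ((d₁ : ℝ) * d₂) + x) : ℝ) : ℂ) • Matrix.vecMulVec Ψ (star Ψ)
        + ((1 / ((d₁ : ℝ) * d₂) - 2 * x / (((d₁ : ℝ) * d₂) - 2) : ℝ) : ℂ) •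
            Matrix.diagonal (fun p : Fin d₁ × Fin d₂ =>
              if p = ((⟨0, by omega⟩ : Fin d₁), (⟨0, by omega⟩ : Fin d₂))
                ∨ p = ((⟨d₁ - 1, by omega⟩ : Fin d₁), (⟨d₂ - 1, by omega⟩ : Fin d₂))
              then 0 else 1))
    (ρT₁ : Matrix (Fin d₁ × Fin d₂) (Fin d₁ × Fin d₂) ℂ)
    (hρT₁ : ρT₁ = Matrix.of fun p q : Fin d₁ × Fin d₂ => ρ (q.1, p.2) (p.1, q.2)) :
    ∃ hherm : ρT₁.IsHermitian,
      (Finset.univ.val.map hherm.eigenvalues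
        = Multiset.replicate 2 (1 / ((d₁ : ℝ) * d₂) + x)
          + Multiset.replicate (d₁ * d₂ - 4) (1 / ((d₁ : ℝ) * d₂) - 2 * x / (((d₁ : ℝ) * d₂) - 2))
          + Multiset.replicate 1 (2 / ((d₁ : ℝ) * d₂) + x * (((d₁ : ℝ) * d₂) - 4) / (((d₁ : ℝ) * d₂) - 2))
          + Multiset.replicate 1 (-(x * ((d₁ : ℝ) * d₂) / (((d₁ : ℝ) * d₂) - 2))))
      ∧ (Finset.univ.filter fun i : Fin d₁ × Fin d₂ => hherm.eigenvalues i < 0).card = 1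
      ∧ 2 * ∑ i ∈ Finset.univ.filter (fun i : Fin d₁ × Fin d₂ => hherm.eigenvalues i < 0),
            |hherm.eigenvalues i|
          = 2 * x * ((d₁ : ℝ) * d₂) / (((d₁ : ℝ) * d₂) - 2)
      ∧ ¬ ∃ (n : ℕ) (w : Fin n → ℝ)
            (A : Fin n → Matrix (Fin d₁) (Fin d₁) ℂ)
            (B : Fin n → Matrix (Fin d₂) (Fin d₂) ℂ),
            (∀ i, 0 ≤ w i) ∧ (∑ i, w i = 1)
            ∧ (∀ i, (A i).PosSemidef ∧ (A i).trace = 1)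
            ∧ (∀ i, (B i).PosSemidef ∧ (B i).trace = 1)
            ∧ ρ = ∑ i, ((w i : ℝ) : ℂ) • (A i ⊗ₖ B i) := by
  obtain ⟨hx0, hx1⟩ := hx
  have hd₁' : (2 : ℝ) ≤ d₁ := by exact_mod_cast hd₁
  have hd₂' : (2 : ℝ) ≤ d₂ := by exact_mod_cast hd₂
  have hD : (4 : ℝ) ≤ (d₁ : ℝ) * d₂ := by nlinarith
  set D : ℝ := (d₁ : ℝ) * d₂
  set c : ℝ := 1 / D + x with hc
  set e : ℝ := 1 / D - 2 * x / (D - 2) with he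
  have hD0 : 0 < D := by linarith
  have hD2 : 0 < D - 2 := by linarith
  have hc0 : 0 < c := by positivity
  have he0 : 0 ≤ e := by
    rw [le_div_iff₀ (by positivity)] at hx1
    rw [he, sub_nonneg, div_le_div_iff₀ hD2 hD0]
    linarith
  have hplus : 2 / D + x * (D - 4) / (D - 2) = e + c := by
    rw [hc, he]
    field_simp
    ring
  have hminus : -(x * D / (D - 2)) = e - c := by
    rw [hc, he]
    field_simp
    ring
  have hneg : e - c < 0 := by
    rw [← hminus, neg_lt_zero]
    positivity
  have hneg' : 2 * x * D / (D - 2) = 2 * |e - c| := by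
    rw [abs_of_neg hneg, ← hminus]
    ring
  rw [hplus, hminus, hneg']
  have hi : (⟨0, by omega⟩ : Fin d₁) ≠ ⟨d₁ - 1, by omega⟩ := by
    simp only [ne_eq, Fin.mk.injEq]; omega
  have hj : (⟨0, by omega⟩ : Fin d₂) ≠ ⟨d₂ - 1, by omega⟩ := by
    simp only [ne_eq, Fin.mk.injEq]; omega
  generalize (⟨0, by omega⟩ : Fin d₁) = i₀ at *
  generalize (⟨d₁ - 1, by omega⟩ : Fin d₁) = i₁ at *
  generalize (⟨0, by omega⟩ : Fin d₂) = j₀ at *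
  generalize (⟨d₂ - 1, by omega⟩ : Fin d₂) = j₁ at *
  set ζ : ℂ := exp (-(θ : ℂ) * I) with hζdef
  have hζ : ζ * star ζ = 1 := by
    rw [hζdef, star_def, ← exp_conj, ← exp_add]
    simp
  have hs : 2 * (((√2 : ℝ) : ℂ)⁻¹ * star ((√2 : ℝ) : ℂ)⁻¹) = 1 := by
    rw [star_def, map_inv₀, conj_ofReal, ← mul_inv, ← ofReal_mul, Real.mul_self_sqrt (by norm_num)]
    norm_num
  have hρherm : ρ.IsHermitian := by
    rw [hρ, IsHermitian]
    simp only [conjTranspose_add, conjTranspose_smul, conjTranspose_vecMulVec, star_star,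
      diagonal_conjTranspose, star_def, conj_ofReal]
    congr 3
    ext p
    simp only [Pi.star_apply]
    split_ifs <;> simp
  have hPT : ρT₁ = ρ.partialTranspose := hρT₁
  have hherm : ρT₁.IsHermitian := hPT ▸ hρherm.partialTranspose
  have hform : ρT₁ = diagonal (fun p => if p = (i₀, j₀) ∨ p = (i₁, j₁) then (c : ℂ) else e)
      + single (i₁, j₀) (i₀, j₁) (c * star ζ) + single (i₀, j₁) (i₁, j₀) (c * ζ) := by
    rw [hPT, hρ, hΨ, ← partialTranspose_pure_add_diagonal hj c e _ ζ hs hζ]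
    push_cast
    rfl
  have hspec := hherm.map_eigenvalues_of_charpoly_eq
    ((fun i => if i = (i₀, j₀) ∨ i = (i₁, j₁) then c else e) + Pi.single (i₁, j₀) c
      - Pi.single (i₀, j₁) c) (by
    rw [hform, charpoly_diagonal_add_single_add_single (by simp [hi.symm])
      _ (by simp [hi, hi.symm, hj, hj.symm]) _ _ _ (by rw [mul_comm, hζ])]
    congr 2
    ext p
    simp only [Pi.add_apply, Pi.sub_apply, Pi.single_apply]
    split_ifs <;> push_cast <;> rfl)
  rw [map_univ_val_add_single_sub_single (by simp [hi]) (by simp [hi]) (by simp [hj]) (by simp [hj.symm])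
    (by simp [hi.symm]) (by simp [hi.symm]), Fintype.card_prod, Fintype.card_fin,
    Fintype.card_fin] at hspec
  have hfilter : (Finset.univ.val.map hherm.eigenvalues).filter (· < 0) = {e - c} := by
    rw [hspec]
    have hnil (k : ℕ) {a : ℝ} (ha : 0 ≤ a) : (Multiset.replicate k a).filter (· < 0) = 0 :=
      Multiset.filter_eq_nil.2 fun b hb => (Multiset.eq_of_mem_replicate hb ▸ ha).not_gt
    rw [Multiset.filter_add, Multiset.filter_add, Multiset.filter_add, hnil _ hc0.le, hnil _ he0,
      hnil _ (add_nonneg he0 hc0.le)]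
    simp [Multiset.filter_singleton, sub_neg.1 hneg]
  rw [Multiset.filter_map] at hfilter
  change (Finset.univ.filter fun i => hherm.eigenvalues i < 0).val.map _ = _ at hfilter
  have hcard : (Finset.univ.filter fun i => hherm.eigenvalues i < 0).card = 1 :=
    (Multiset.card_map _ _).symm.trans (congrArg Multiset.card hfilter)
  refine ⟨hherm, hspec, hcard, ?_, ?_⟩
  · have h := congrArg (fun t => (t.map abs).sum) hfilter
    simp only [Multiset.map_map, Multiset.map_singleton, Multiset.sum_singleton] at h
    rw [← h]
    rfl
  · rintro ⟨n, w, A, B, hw, -, hA, hB, hsep⟩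
    have hpsd : ρT₁.PosSemidef := by
      rw [hPT, hsep]
      exact posSemidef_partialTranspose_of_separable w A B hw (fun i => (hA i).1)
        fun i => (hB i).1
    obtain ⟨i, hi⟩ := Finset.card_pos.1 (hcard ▸ one_pos)
    exact (Finset.mem_filter.1 hi).2.not_ge (hpsd.eigenvalues_nonneg i)
end
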